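/- (No exotic C^k structures on ℝ².) Let k ≥ 1 (possibly k = ∞) and let A be any maximal C^k atlas on the topological space ℝ² making it a C^k 2-dimensional manifold without boundary. Then there exists a homeomorphism h : ℝ² → ℝ² which is a C^k diffeomorphism from (ℝ², A) onto ℝ² equipped with its standard C^k structure S^k (i.e., h is C^k with respect to A and S^k and h⁻¹ is C^k with respect to S^k and A). -/

import Mathlib

noncomputable section

open scoped Manifold

namespace PlaneStructure

open Set Topology

/-- A continuous self-map of `ℂ` that is a translation near infinity attains the value `0`. -/
theorem exists_eq_zero_of_translation_near_infinity {g : ℂ → ℂ} (hg : Continuous g) (w : ℂ) (R : ℝ)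
    (hR : ∀ z, R ≤ ‖z‖ → g z = z - w) : ∃ z, g z = 0 := by
  by_contra! hne
  obtain ⟨lam, ⟨-, hlam⟩, -⟩ := Complex.isCoveringMapOn_exp.existsUnique_continuousMap_lifts
    ⟨g, hg⟩ (a₀ := 0) (e₀ := Complex.log (g 0)) (Complex.exp_log (hne 0))
    (fun a => by simpa using hne a)
  have hexp : ∀ z, Complex.exp (lam z) = g z := fun z => congrFun hlam z
  set ρ : ℝ := |R| + ‖w‖ + 1 with hρ
  have hρ0 : 0 < ρ := by positivity
  let circ : ℝ → ℂ := fun θ => w + ρ * Complex.exp (θ * Complex.I)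
  have hcirc : Continuous circ := by fun_prop
  have hgc : ∀ θ, g (circ θ) = ρ * Complex.exp (θ * Complex.I) := by
    intro θ
    rw [hR]
    · simp [circ]
    · have h1 : ‖(ρ : ℂ) * Complex.exp (θ * Complex.I)‖ = ρ := by
        simp [Complex.norm_exp_ofReal_mul_I, abs_of_pos hρ0]
      have h2 := norm_sub_norm_le ((ρ : ℂ) * Complex.exp (θ * Complex.I)) (-w)
      rw [h1, norm_neg, sub_neg_eq_add, add_comm _ w] at h2
      linarith [le_abs_self R]
  set c : ℂ := lam (circ 0)
  have hc : Complex.exp c = ρ := by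
    rw [hexp, hgc]; simp
  obtain ⟨F, -, hF⟩ := Complex.isCoveringMapOn_exp.existsUnique_continuousMap_lifts
    ⟨fun θ => g (circ θ), hg.comp hcirc⟩ (a₀ := (0 : ℝ)) (e₀ := c) (hexp _)
    (fun a => by simpa using hne _)
  have e1 := hF (lam.comp ⟨circ, hcirc⟩) ⟨rfl, funext fun θ => hexp _⟩
  have e2 := hF ⟨fun θ : ℝ => c + θ * Complex.I, by fun_prop⟩ ⟨by simp, funext fun θ => by
    simp [Complex.exp_add, hc, hgc]⟩
  have e3 := congrArg (fun f : C(ℝ, ℂ) => f (2 * Real.pi)) (e1.trans e2.symm)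
  have e4 : circ (2 * Real.pi) = circ 0 := by simp [circ, Complex.exp_two_pi_mul_I]
  simp only [ContinuousMap.comp_apply, ContinuousMap.coe_mk, e4] at e3
  simp [c] at e3

section
variable {M : Type*} [TopologicalSpace M]

/-- A continuous self-map of a topological plane that is the identity off a compact set is onto. -/
theorem surjective_of_eqOn_compl_isCompact (h : M ≃ₜ ℝ × ℝ) {G : M → M} (hG : Continuous G)
    {K : Set M} (hK : IsCompact K) (hGK : ∀ m ∉ K, G m = m) : Function.Surjective G := by
  intro a
  let h' : M ≃ₜ ℂ := h.trans Complex.equivRealProdCLM.symm.toHomeomorph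
  obtain ⟨R, hR⟩ := (hK.image h'.continuous).isBounded.exists_norm_le
  obtain ⟨z, hz⟩ := exists_eq_zero_of_translation_near_infinity
    (g := fun z => h' (G (h'.symm z)) - h' a) (by fun_prop) (h' a) (R + 1) (fun z hz => by
      rw [hGK, h'.apply_symm_apply]
      intro hzK
      have := hR z ⟨_, hzK, h'.apply_symm_apply z⟩
      linarith)
  exact ⟨h'.symm z, h'.injective (sub_eq_zero.mp hz)⟩

/-- In a topological plane, an open subset that is itself a topological plane and contains the
boundary of an embedded compact planar set contains the whole set. -/
theorem image_subset_of_image_frontier_subset [T2Space M] (h : M ≃ₜ ℝ × ℝ) {W : Set M}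
    (hW : Nonempty (W ≃ₜ ℝ × ℝ)) {c : ℝ × ℝ → M} (hc : IsOpenEmbedding c) {B : Set (ℝ × ℝ)}
    (hB : IsCompact B) (hBW : c '' frontier B ⊆ W) : c '' B ⊆ W := by
  classical
  obtain ⟨e⟩ := hW
  rintro _ ⟨b, hb, rfl⟩
  by_contra hbW
  have hbi : b ∈ interior B := by
    by_contra hbi
    exact hbW (hBW ⟨b, by rw [hB.isClosed.frontier_eq]; exact ⟨hb, hbi⟩, rfl⟩)
  let f : C(frontier B, ℝ × ℝ) :=
    ⟨fun p => e ⟨c p, hBW ⟨p, p.2, rfl⟩⟩, by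
      have := hc.continuous
      fun_prop⟩
  obtain ⟨g, hg⟩ := f.exists_restrict_eq isClosed_frontier
  let r : ℝ × ℝ → M := fun p => e.symm (g p)
  have hr : Continuous r := by fun_prop
  have hrf : ∀ p ∈ frontier B, r p = c p := by
    intro p hp
    have : g p = f ⟨p, hp⟩ := by rw [← hg]; rfl
    simp [r, this, f]
  let φ := hc.toOpenPartialHomeomorph c
  have hφ : ∀ p, φ.symm (c p) = p := fun p => φ.left_inv (by simp [φ])
  have hφc : ContinuousOn φ.symm (range c) := by
    have := φ.continuousOn_symm
    simpa [φ] using this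
  let G : M → M := fun m => if m ∈ c '' B then r (φ.symm m) else m
  have hcl : IsClosed (c '' B) := (hB.image hc.continuous).isClosed
  have hop : IsOpen (c '' interior B) := hc.isOpenMap _ isOpen_interior
  have hG1 : ContinuousOn G (c '' B) := by
    refine ContinuousOn.congr (f := fun m => r (φ.symm m)) ?_ (fun m hm => if_pos hm)
    exact hr.comp_continuousOn (hφc.mono (image_subset_range _ _))
  have hG2 : ContinuousOn G (c '' interior B)ᶜ := by
    refine continuousOn_id.congr (fun m hm => ?_)
    by_cases hmB : m ∈ c '' B
    · obtain ⟨p, hp, rfl⟩ := hmB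
      have hpf : p ∈ frontier B := by
        rw [hB.isClosed.frontier_eq]
        exact ⟨hp, fun hpi => hm ⟨p, hpi, rfl⟩⟩
      simp only [G, if_pos (mem_image_of_mem c hp), hφ, id, hrf p hpf]
    · simp only [G, if_neg hmB, id]
  have hG : Continuous G := by
    rw [← continuousOn_univ]
    have : (univ : Set M) = c '' B ∪ (c '' interior B)ᶜ := by
      rw [eq_comm, eq_univ_iff_forall]
      intro m
      by_cases hm : m ∈ c '' interior B
      · exact Or.inl (image_mono interior_subset hm)
      · exact Or.inr hm
    rw [this]
    exact hG1.union_of_isClosed hG2 hcl hop.isClosed_compl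
  obtain ⟨m, hm⟩ := surjective_of_eqOn_compl_isCompact h hG (hB.image hc.continuous)
    (fun m hm => if_neg hm) (c b)
  by_cases hmB : m ∈ c '' B
  · simp only [G, if_pos hmB] at hm
    exact hbW (hm ▸ (e.symm _).2)
  · simp only [G, if_neg hmB] at hm
    exact hmB (hm ▸ mem_image_of_mem c hb)

end

section Diffeo

variable {E H M : Type*} [NormedAddCommGroup E] [NormedSpace ℝ E] [TopologicalSpace H]
  {I : ModelWithCorners ℝ E H} [TopologicalSpace M] [ChartedSpace H M] {k : ℕ∞}

/-- A self-map is a `C^k` diffeomorphism: a bijective local diffeomorphism. -/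
def IsDiffeo (I : ModelWithCorners ℝ E H) (k : ℕ∞) (f : M → M) : Prop :=
  IsLocalDiffeomorph I I k f ∧ Function.Bijective f

theorem IsDiffeo.id : IsDiffeo I k (id : M → M) :=
  ⟨(Diffeomorph.refl I M k).isLocalDiffeomorph, Function.bijective_id⟩

theorem IsDiffeo.comp {f g : M → M} (hg : IsDiffeo I k g) (hf : IsDiffeo I k f) :
    IsDiffeo I k (g ∘ f) :=
  ⟨fun x => (hf.1 x).comp I M (hg.1 (f x)), hg.2.comp hf.2⟩

theorem IsDiffeo.iterate {f : M → M} (hf : IsDiffeo I k f) (n : ℕ) : IsDiffeo I k f^[n] := by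
  induction n with
  | zero => exact .id
  | succ n ih => exact ih.comp hf

theorem IsDiffeo.exists_inverse {f : M → M} (hf : IsDiffeo I k f) :
    ∃ g : M → M, IsDiffeo I k g ∧ Function.LeftInverse g f ∧ Function.RightInverse g f := by
  let Φ := hf.1.diffeomorphOfBijective hf.2
  exact ⟨Φ.symm, ⟨Φ.symm.isLocalDiffeomorph, Φ.symm.bijective⟩, Φ.left_inv, Φ.right_inv⟩

theorem IsDiffeo.continuous {f : M → M} (hf : IsDiffeo I k f) : Continuous f :=
  hf.1.isLocalHomeomorph.continuous

/-- A `C^k` diffeomorphism as a homeomorphism. -/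
def IsDiffeo.toHomeomorph {f : M → M} (hf : IsDiffeo I k f) : M ≃ₜ M :=
  (Equiv.ofBijective f hf.2).toHomeomorphOfContinuousOpen hf.continuous hf.1.isOpenMap

end Diffeo

section Perturbation

variable {E : Type*} [NormedAddCommGroup E] [NormedSpace ℝ E] [FiniteDimensional ℝ E] {k : ℕ∞}

/-- Small compactly supported smooth perturbations of the identity are diffeomorphisms. -/
theorem isDiffeo_sub_smul {u : E → E} (hu : ContDiff ℝ k u) (hk : 1 ≤ k)
    (hc : HasCompactSupport u) :
    ∃ L : NNReal, LipschitzWith L u ∧ ∀ s : ℝ, 0 < s → s * L < 1 →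
      IsDiffeo 𝓘(ℝ, E) k (fun p => p - s • u p) := by
  have := FiniteDimensional.complete ℝ E
  obtain ⟨L, hL⟩ := hu.lipschitzWith_of_hasCompactSupport hc (by
    intro h; simp at h; simp [h] at hk)
  refine ⟨L, hL, fun s hs hsL => ?_⟩
  have hder : ∀ p, HasFDerivAt (fun p => p - s • u p)
      (ContinuousLinearMap.id ℝ E - s • fderiv ℝ u p) p := by
    intro p
    have : DifferentiableAt ℝ u p := (hu.differentiable (by
      intro h; simp at h; simp [h] at hk)).differentiableAt
    exact (hasFDerivAt_id p).sub (this.hasFDerivAt.const_smul s)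
  have hnorm : ∀ p, ‖s • fderiv ℝ u p‖ < 1 := by
    intro p
    rw [norm_smul, Real.norm_of_nonneg hs.le]
    exact lt_of_le_of_lt (mul_le_mul_of_nonneg_left (norm_fderiv_le_of_lipschitz ℝ hL) hs.le) hsL
  have happrox : ApproximatesLinearOn (fun p => p - s • u p)
      ((ContinuousLinearEquiv.refl ℝ E : E ≃L[ℝ] E) : E →L[ℝ] E) univ (s.toNNReal * L) := by
    intro x _ y _
    have h1 := hL.dist_le_mul x y
    rw [dist_eq_norm, dist_eq_norm] at h1
    have : x - s • u x - (y - s • u y) - (ContinuousLinearEquiv.refl ℝ E : E →L[ℝ] E) (x - y)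
        = - (s • (u x - u y)) := by
      simp [smul_sub]; abel
    rw [this, norm_neg, norm_smul, Real.norm_of_nonneg hs.le]
    rw [NNReal.coe_mul, Real.coe_toNNReal s hs.le, mul_assoc]
    exact mul_le_mul_of_nonneg_left h1 hs.le
  rcases subsingleton_or_nontrivial E with hE | hE
  · have : (fun p => p - s • u p) = (id : E → E) := by
      funext p; exact Subsingleton.elim _ _
    rw [this]; exact .id
  have hbound : s.toNNReal * L <
      ‖((ContinuousLinearEquiv.refl ℝ E : E ≃L[ℝ] E).symm : E →L[ℝ] E)‖₊⁻¹ := by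
    have : ‖((ContinuousLinearEquiv.refl ℝ E : E ≃L[ℝ] E).symm : E →L[ℝ] E)‖₊ = 1 := by
      ext
      exact ContinuousLinearMap.norm_id
    rw [this, inv_one]
    rw [← NNReal.coe_lt_coe, NNReal.coe_mul, Real.coe_toNNReal s hs.le]
    exact hsL
  let F : E ≃ₜ E := happrox.toHomeomorph _ (Or.inr hbound)
  have hF : ⇑F = fun p => p - s • u p := rfl
  have hFd : ContDiff ℝ k F := by
    rw [hF]; exact contDiff_id.sub (contDiff_const.smul hu)
  have hsymm : ContDiff ℝ k F.symm := by
    refine F.contDiff_symm (f₀' := fun p =>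
      ContinuousLinearEquiv.ofUnit (Units.oneSub _ (hnorm p))) (fun a => ?_) hFd
    exact hder a
  let D : E ≃ₘ^k⟮𝓘(ℝ, E), 𝓘(ℝ, E)⟯ E :=
    { toEquiv := F.toEquiv, contMDiff_toFun := hFd.contMDiff, contMDiff_invFun := hsymm.contMDiff }
  exact ⟨D.isLocalDiffeomorph, D.bijective⟩

end Perturbation

/-- A smooth plateau function on the line. -/
theorem exists_plateau {a a' b' b : ℝ} (ha : a < a') (hb : b' < b) :
    ∃ β : ℝ → ℝ, ContDiff ℝ (⊤ : ℕ∞) β ∧ (∀ x, 0 ≤ β x) ∧ (∀ x, β x ≤ 1) ∧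
      (∀ x, x ∉ Ioo a b → β x = 0) ∧ ∀ x ∈ Icc a' b', β x = 1 := by
  refine ⟨fun x => Real.smoothTransition ((x - a) / (a' - a)) *
    Real.smoothTransition ((b - x) / (b - b')), ?_, ?_, ?_, ?_, ?_⟩
  · exact (Real.smoothTransition.contDiff.comp (by fun_prop)).mul
      (Real.smoothTransition.contDiff.comp (by fun_prop))
  · exact fun x => mul_nonneg (Real.smoothTransition.nonneg _) (Real.smoothTransition.nonneg _)
  · exact fun x => mul_le_one₀ (Real.smoothTransition.le_one _) (Real.smoothTransition.nonneg _)
      (Real.smoothTransition.le_one _)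
  · intro x hx
    beta_reduce
    rw [mem_Ioo, not_and_or, not_lt, not_lt] at hx
    rcases hx with hx | hx
    · rw [Real.smoothTransition.zero_of_nonpos, zero_mul]
      exact div_nonpos_of_nonpos_of_nonneg (by linarith) (by linarith)
    · rw [mul_comm, Real.smoothTransition.zero_of_nonpos, zero_mul]
      exact div_nonpos_of_nonpos_of_nonneg (by linarith) (by linarith)
  · intro x hx
    beta_reduce
    rw [Real.smoothTransition.one_of_one_le, Real.smoothTransition.one_of_one_le, one_mul]
    · rw [one_le_div (by linarith)]; linarith [hx.2]
    · rw [one_le_div (by linarith)]; linarith [hx.1]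

/-- A diffeomorphism of the plane supported in a box which pushes points vertically down. -/
theorem exists_push {k : ℕ∞} (hk : 1 ≤ k) {a a' b' b c c' d' d : ℝ} (ha : a < a') (hb : b' < b)
    (hc : c < c') (hd : d' < d) :
    ∃ ψ : ℝ × ℝ → ℝ × ℝ, IsDiffeo 𝓘(ℝ, ℝ × ℝ) k ψ ∧ (∀ p, p ∉ Icc a b ×ˢ Icc c d → ψ p = p) ∧
      (∀ p, (ψ p).1 = p.1) ∧ (∀ p, (ψ p).2 ≤ p.2) ∧ (∀ p, c ≤ p.2 → c ≤ (ψ p).2) ∧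
      ∀ p, p.1 ∈ Icc a' b' → p.2 ≤ d' → (ψ p).2 ≤ c' := by
  obtain ⟨β, hβ, hβ0, hβ1, hβs, hβp⟩ := exists_plateau ha hb
  obtain ⟨γ, hγ, hγ0, hγ1, hγs, hγp⟩ := exists_plateau hc hd
  let u : ℝ × ℝ → ℝ × ℝ := fun p => (0, β p.1 * γ p.2)
  have hu : ContDiff ℝ k u := by
    have : ContDiff ℝ (⊤ : ℕ∞) u := by
      refine contDiff_const.prodMk ((hβ.comp contDiff_fst).mul (hγ.comp contDiff_snd))
    exact this.of_le (by exact_mod_cast le_top)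
  have hu0 : ∀ p, p ∉ Icc a b ×ˢ Icc c d → u p = 0 := by
    intro p hp
    have : p.1 ∉ Ioo a b ∨ p.2 ∉ Ioo c d := by
      by_contra! h
      exact hp ⟨Ioo_subset_Icc_self h.1, Ioo_subset_Icc_self h.2⟩
    rcases this with h | h
    · simp [u, hβs _ h]
    · simp [u, hγs _ h]
  obtain ⟨L, hL, hdiff⟩ := isDiffeo_sub_smul hu hk
    (HasCompactSupport.intro (isCompact_Icc.prod isCompact_Icc) hu0)
  set s : ℝ := 1 / (L + 1) with hs
  have hL0 : (0 : ℝ) ≤ L := L.2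
  have hs0 : 0 < s := by positivity
  have hsL : s * L < 1 := by
    rw [hs, one_div, inv_mul_lt_iff₀ (by positivity)]; linarith
  let σ : ℝ × ℝ → ℝ × ℝ := fun p => p - s • u p
  have hσ : IsDiffeo 𝓘(ℝ, ℝ × ℝ) k σ := hdiff s hs0 hsL
  have hσ1 : ∀ p, (σ p).1 = p.1 := fun p => by simp [σ, u]
  have hσ2 : ∀ p, (σ p).2 = p.2 - s * (β p.1 * γ p.2) := fun p => by simp [σ, u]
  have hσle : ∀ p, (σ p).2 ≤ p.2 := fun p => by
    rw [hσ2]; have := mul_nonneg hs0.le (mul_nonneg (hβ0 p.1) (hγ0 p.2)); linarith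
  have hσge : ∀ p, c ≤ p.2 → c ≤ (σ p).2 := by
    intro p hp
    have h1 := hL.dist_le_mul p (p.1, c)
    have h2 : u (p.1, c) = 0 := by simp [u, hγs c (by simp)]
    rw [h2, dist_zero_right] at h1
    have h3 : dist p (p.1, c) = p.2 - c := by
      rw [Prod.dist_eq]; simp [Real.dist_eq, abs_of_nonneg (sub_nonneg.2 hp), hp]
    have h4 : β p.1 * γ p.2 ≤ ‖u p‖ := by
      rw [Prod.norm_def]
      exact (le_abs_self _).trans (le_max_right _ _)
    rw [h3] at h1
    rw [hσ2]
    have : s * (β p.1 * γ p.2) ≤ s * (L * (p.2 - c)) :=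
      mul_le_mul_of_nonneg_left (h4.trans h1) hs0.le
    nlinarith
  have hit : ∀ n p, (σ^[n] p).1 = p.1 ∧ (σ^[n] p).2 ≤ p.2 ∧ (c ≤ p.2 → c ≤ (σ^[n] p).2) ∧
      (p.1 ∈ Icc a' b' → p.2 ≤ d' → (σ^[n] p).2 ≤ max c' (d' - n * s)) := by
    intro n
    induction n with
    | zero => intro p; simp; tauto
    | succ n ih =>
      intro p
      obtain ⟨h1, h2, h3, h4⟩ := ih p
      rw [Function.iterate_succ_apply']
      refine ⟨by rw [hσ1, h1], (hσle _).trans h2, fun h => hσge _ (h3 h), fun h h' => ?_⟩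
      have h5 := h4 h h'
      by_cases h6 : (σ^[n] p).2 ≤ c'
      · exact (hσle _).trans (h6.trans (le_max_left _ _))
      · push Not at h6
        have h7 : (σ^[n] p).2 ≤ d' - n * s := by
          rcases le_max_iff.1 h5 with h | h
          · linarith
          · exact h
        rw [hσ2, h1, hβp _ h, hγp _ ⟨h6.le, h2.trans h'⟩]
        refine le_max_of_le_right ?_
        push_cast; linarith
  obtain ⟨n, hn⟩ := exists_nat_ge ((d' - c') / s)
  rw [div_le_iff₀ hs0] at hn
  refine ⟨σ^[n], hσ.iterate n, fun p hp => ?_, fun p => (hit n p).1, fun p => (hit n p).2.1,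
    fun p => (hit n p).2.2.1, fun p h h' => ((hit n p).2.2.2 h h').trans ?_⟩
  · exact Function.iterate_fixed (by simp [σ, hu0 p hp]) n
  · exact max_le le_rfl (by linarith)

section Engulfing

variable {E H M : Type*} [NormedAddCommGroup E] [NormedSpace ℝ E] [TopologicalSpace H]
  {I : ModelWithCorners ℝ E H} [TopologicalSpace M] [ChartedSpace H M] {k : ℕ∞}

/-- A `C^k` parametrization of an open subset of `M` by the plane. -/
def IsPar (I : ModelWithCorners ℝ E H) (k : ℕ∞) (c : ℝ × ℝ → M) : Prop :=
  IsLocalDiffeomorph 𝓘(ℝ, ℝ × ℝ) I k c ∧ Function.Injective c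

theorem IsPar.isOpenEmbedding {c : ℝ × ℝ → M} (hc : IsPar I k c) : IsOpenEmbedding c :=
  .of_continuous_injective_isOpenMap hc.1.isLocalHomeomorph.continuous hc.2 hc.1.isOpenMap

theorem IsPar.continuous {c : ℝ × ℝ → M} (hc : IsPar I k c) : Continuous c :=
  hc.isOpenEmbedding.continuous

theorem IsPar.comp_isDiffeo {c : ℝ × ℝ → M} (hc : IsPar I k c) {f : ℝ × ℝ → ℝ × ℝ}
    (hf : IsDiffeo 𝓘(ℝ, ℝ × ℝ) k f) : IsPar I k (c ∘ f) :=
  ⟨fun x => (hf.1 x).comp I M (hc.1 (f x)), hc.2.comp hf.2.1⟩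

theorem IsDiffeo.comp_isPar {c : ℝ × ℝ → M} {f : M → M}
    (hf : IsDiffeo I k f) (hc : IsPar I k c) : IsPar I k (f ∘ c) :=
  ⟨fun x => (hc.1 x).comp I M (hf.1 (c x)), hf.2.1.comp hc.2⟩

theorem isDiffeo_of_contDiff_inverse {f g : ℝ × ℝ → ℝ × ℝ} (hf : ContDiff ℝ k f)
    (hg : ContDiff ℝ k g) (hgf : Function.LeftInverse g f) (hfg : Function.RightInverse g f) :
    IsDiffeo 𝓘(ℝ, ℝ × ℝ) k f :=
  let D : (ℝ × ℝ) ≃ₘ^k⟮𝓘(ℝ, ℝ × ℝ), 𝓘(ℝ, ℝ × ℝ)⟯ (ℝ × ℝ) :=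
    { toFun := f, invFun := g, left_inv := hgf, right_inv := hfg,
      contMDiff_toFun := hf.contMDiff, contMDiff_invFun := hg.contMDiff }
  ⟨D.isLocalDiffeomorph, D.bijective⟩

/-- Extension by the identity of a compactly supported diffeomorphism of a coordinate plane. -/
theorem IsPar.exists_extension [T2Space M] {c : ℝ × ℝ → M} (hc : IsPar I k c) {ψ : ℝ × ℝ → ℝ × ℝ}
    (hψ : IsDiffeo 𝓘(ℝ, ℝ × ℝ) k ψ) {C : Set (ℝ × ℝ)} (hC : IsCompact C)
    (hid : ∀ p, p ∉ C → ψ p = p) :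
    ∃ φ : M → M, IsDiffeo I k φ ∧ (∀ p, φ (c p) = c (ψ p)) ∧ ∀ x, x ∉ c '' C → φ x = x := by
  let φ : M → M := Function.extend c (c ∘ ψ) id
  have h1 : ∀ p, φ (c p) = c (ψ p) := fun p => hc.2.extend_apply _ _ p
  have h2 : ∀ x, x ∉ c '' C → φ x = x := by
    intro x hx
    by_cases h : x ∈ range c
    · obtain ⟨p, rfl⟩ := h
      rw [h1, hid p fun hp => hx ⟨p, hp, rfl⟩]
    · exact Function.extend_apply' _ _ _ fun ⟨p, hp⟩ => h ⟨p, hp⟩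
  have h3 : ∀ x, x ∉ range c → φ x = x := fun x hx =>
    h2 x fun ⟨p, _, hp⟩ => hx ⟨p, hp⟩
  refine ⟨φ, ⟨fun x => ?_, ?_, ?_⟩, h1, h2⟩
  · by_cases h : x ∈ range c
    · obtain ⟨p, rfl⟩ := h
      have hinv := (hc.1 p).localInverse_isLocalDiffeomorphAt
      obtain ⟨Φ, hΦ, hΦe⟩ := hinv.comp I M ((hc.comp_isDiffeo hψ).1 _)
      have hO := (hc.1 p).localInverse_open_source
      let Ψ : PartialDiffeomorph I I M M k :=
        { toPartialEquiv := Φ.toPartialEquiv.restr (hc.1 p).localInverse.source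
          open_source := Φ.open_source.inter hO
          open_target := Φ.toOpenPartialHomeomorph.isOpen_inter_preimage_symm hO
          contMDiffOn_toFun := Φ.contMDiffOn_toFun.mono inter_subset_left
          contMDiffOn_invFun := Φ.contMDiffOn_invFun.mono inter_subset_left }
      refine ⟨Ψ, ⟨hΦ, (hc.1 p).localInverse_mem_source⟩, fun y hy => ?_⟩
      have h5 := (hc.1 p).localInverse_right_inv hy.2
      have h6 := hΦe hy.1
      rw [Function.comp_apply, Function.comp_apply, ← h1, h5] at h6
      exact h6
    · have hO : IsOpen (c '' C)ᶜ := (hC.image hc.continuous).isClosed.isOpen_compl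
      let Ψ : PartialDiffeomorph I I M M k :=
        { toPartialEquiv := PartialEquiv.ofSet (c '' C)ᶜ
          open_source := hO
          open_target := hO
          contMDiffOn_toFun := contMDiffOn_id
          contMDiffOn_invFun := contMDiffOn_id }
      exact ⟨Ψ, fun ⟨p, _, hp⟩ => h ⟨p, hp⟩, fun y hy => h2 y hy⟩
  · intro x y hxy
    by_cases hx : x ∈ range c <;> by_cases hy : y ∈ range c
    · obtain ⟨p, rfl⟩ := hx
      obtain ⟨q, rfl⟩ := hy
      rw [h1, h1] at hxy
      rw [hψ.2.1 (hc.2 hxy)]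
    · obtain ⟨p, rfl⟩ := hx
      rw [h1, h3 _ hy] at hxy
      exact absurd ⟨_, hxy⟩ hy
    · obtain ⟨p, rfl⟩ := hy
      rw [h1, h3 _ hx] at hxy
      exact absurd ⟨_, hxy.symm⟩ hx
    · rwa [h3 _ hx, h3 _ hy] at hxy
  · intro x
    by_cases hx : x ∈ range c
    · obtain ⟨p, rfl⟩ := hx
      obtain ⟨q, rfl⟩ := hψ.2.2 p
      exact ⟨c q, h1 q⟩
    · exact ⟨x, h3 x hx⟩

/-- `W` engulfs `T` relative to `B`: some diffeomorphism fixing `B` pointwise moves `T`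
into `W`. -/
def Engulfs (I : ModelWithCorners ℝ E H) (k : ℕ∞) (B W T : Set M) : Prop :=
  ∃ φ : M → M, IsDiffeo I k φ ∧ (∀ x ∈ B, φ x = x) ∧ MapsTo φ T W

/-- Pushing an arc of a coordinate line into an open set. -/
theorem IsPar.engulfs_segment [T2Space M] (hk : 1 ≤ k) {c : ℝ × ℝ → M} (hc : IsPar I k c)
    {B W : Set M} (hW : IsOpen W) (hB : IsClosed B) (h0 : c (0, 0) ∈ W)
    (hBc : ∀ y ∈ Ioc (0 : ℝ) 1, c (0, y) ∉ B) :
    Engulfs I k B W (c '' ({0} ×ˢ Icc 0 1)) := by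
  have hW' : IsOpen (c ⁻¹' W) := hW.preimage hc.continuous
  have hB' : IsOpen (c ⁻¹' Bᶜ) := hB.isOpen_compl.preimage hc.continuous
  obtain ⟨δ₀, hδ₀, hδW₀⟩ := Metric.isOpen_iff.1 hW' (0, 0) h0
  obtain ⟨δ, hδ, hδ1, hδW⟩ : ∃ δ > 0, δ ≤ 1 ∧ Metric.ball ((0 : ℝ), (0 : ℝ)) δ ⊆ c ⁻¹' W :=
    ⟨min δ₀ 1, by positivity, min_le_right _ _,
      (Metric.ball_subset_ball (min_le_left _ _)).trans hδW₀⟩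
  have hK : IsCompact (({0} : Set ℝ) ×ˢ Icc (δ / 3) (1 : ℝ)) :=
      isCompact_singleton.prod isCompact_Icc
  obtain ⟨ε, hε, hεB⟩ := hK.exists_cthickening_subset_open hB' (by
    rintro ⟨x, y⟩ ⟨hx, hy⟩
    simp only [mem_singleton_iff] at hx
    subst hx
    exact hBc y ⟨by linarith [hy.1], hy.2⟩)
  obtain ⟨ψ, hψ, hid, hψ1, hψle, hψge, hψp⟩ := exists_push (k := k) hk (a := -ε) (a' := 0) (b' := 0)
    (b := ε) (c := δ / 3) (c' := δ / 2) (d' := 1) (d := 1 + ε) (by linarith) (by linarith)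
    (by linarith) (by linarith)
  obtain ⟨φ, hφ, hφc, hφid⟩ := hc.exists_extension hψ (isCompact_Icc.prod isCompact_Icc) hid
  refine ⟨φ, hφ, fun x hx => hφid x ?_, ?_⟩
  · rintro ⟨⟨x, y⟩, ⟨hx1, hx2⟩, rfl⟩
    dsimp only at hx1 hx2
    refine hεB (Metric.mem_cthickening_of_dist_le (x, y) (0, min y 1) ε _
      ⟨rfl, le_min hx2.1 (by linarith), min_le_right _ _⟩ ?_) hx
    rw [Prod.dist_eq, Real.dist_eq, Real.dist_eq]
    refine max_le (by simpa [abs_le] using hx1) ?_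
    rw [abs_le]
    rcases min_cases y 1 with h | h <;> constructor <;> linarith [hx2.2]
  · rintro _ ⟨⟨x, y⟩, ⟨hx, hy⟩, rfl⟩
    simp only [mem_singleton_iff] at hx
    subst hx
    rw [hφc]
    refine hδW ?_
    have e1 := hψ1 (0, y)
    have e2 := hψle (0, y)
    have e3 := hψge (0, y)
    have e4 := hψp (0, y) ⟨le_rfl, le_rfl⟩ hy.2
    have hy0 := hy.1
    dsimp only at e1 e2 e3 e4 hy0
    rw [Metric.mem_ball, Prod.dist_eq, e1, Real.dist_eq, Real.dist_eq]
    refine max_lt (by simpa using hδ) ?_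
    rw [sub_zero, abs_lt]
    refine ⟨?_, by linarith⟩
    by_cases h : δ / 3 ≤ y
    · linarith [e3 h]
    · rw [hid (0, y) fun h' => h h'.2.1]
      dsimp only
      linarith

/-- Pushing the top side of a coordinate square into an open set containing the three
other sides. -/
theorem IsPar.engulfs_top [T2Space M] (hk : 1 ≤ k) {c : ℝ × ℝ → M} (hc : IsPar I k c)
    {B W : Set M} (hW : IsOpen W) (hB : IsClosed B) (hbot : ∀ x ∈ Icc (0 : ℝ) 1, c (x, 0) ∈ W)
    (hleft : ∀ y ∈ Icc (0 : ℝ) 1, c (0, y) ∈ W) (hright : ∀ y ∈ Icc (0 : ℝ) 1, c (1, y) ∈ W)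
    (hBc : ∀ x ∈ Ioo (0 : ℝ) 1, ∀ y ∈ Ioc (0 : ℝ) 1, c (x, y) ∉ B) :
    Engulfs I k B W (c '' (Icc 0 1 ×ˢ {1})) := by
  have hW' : IsOpen (c ⁻¹' W) := hW.preimage hc.continuous
  have hB' : IsOpen (c ⁻¹' Bᶜ) := hB.isOpen_compl.preimage hc.continuous
  have hU : IsCompact (Icc (0 : ℝ) 1 ×ˢ ({0} : Set ℝ) ∪ (({0} : Set ℝ) ×ˢ Icc (0 : ℝ) 1 ∪
      ({1} : Set ℝ) ×ˢ Icc (0 : ℝ) 1)) :=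
    (isCompact_Icc.prod isCompact_singleton).union ((isCompact_singleton.prod isCompact_Icc).union
      (isCompact_singleton.prod isCompact_Icc))
  obtain ⟨δ₀, hδ₀, hδW₀⟩ := hU.exists_cthickening_subset_open hW' (by
    rintro ⟨x, y⟩ (⟨hx, hy⟩ | ⟨hx, hy⟩ | ⟨hx, hy⟩) <;> simp only [mem_singleton_iff] at hx hy <;>
      subst_vars
    exacts [hbot x hx, hleft y hy, hright y hy])
  obtain ⟨δ, hδ, hδ1, hδW⟩ : ∃ δ > 0, δ < 1 / 2 ∧
      Metric.cthickening δ (Icc (0 : ℝ) 1 ×ˢ ({0} : Set ℝ) ∪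
      (({0} : Set ℝ) ×ˢ Icc (0 : ℝ) 1 ∪ ({1} : Set ℝ) ×ˢ Icc (0 : ℝ) 1)) ⊆ c ⁻¹' W :=
    ⟨min δ₀ (1 / 3), by positivity, (min_le_right _ _).trans_lt (by norm_num),
      (Metric.cthickening_mono (min_le_left _ _) _).trans hδW₀⟩
  have hK : IsCompact (Icc (δ / 2) (1 - δ / 2) ×ˢ Icc (δ / 2) (1 : ℝ)) :=
    isCompact_Icc.prod isCompact_Icc
  obtain ⟨ε, hε, hεB⟩ := hK.exists_cthickening_subset_open hB' (by
    rintro ⟨x, y⟩ ⟨hx, hy⟩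
    exact hBc x ⟨by linarith [hx.1], by linarith [hx.2]⟩ y ⟨by linarith [hy.1], hy.2⟩)
  obtain ⟨ψ, hψ, hid, hψ1, hψle, hψge, hψp⟩ := exists_push (k := k) hk (a := δ / 2) (a' := δ)
    (b' := 1 - δ) (b := 1 - δ / 2) (c := δ / 2) (c' := δ) (d' := 1) (d := 1 + ε)
    (by linarith) (by linarith) (by linarith) (by linarith)
  obtain ⟨φ, hφ, hφc, hφid⟩ := hc.exists_extension hψ (isCompact_Icc.prod isCompact_Icc) hid
  refine ⟨φ, hφ, fun x hx => hφid x ?_, ?_⟩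
  · rintro ⟨⟨x, y⟩, ⟨hx1, hx2⟩, rfl⟩
    dsimp only at hx1 hx2
    refine hεB (Metric.mem_cthickening_of_dist_le (x, y) (x, min y 1) ε _
      ⟨hx1, le_min hx2.1 (by linarith), min_le_right _ _⟩ ?_) hx
    rw [Prod.dist_eq, dist_self, Real.dist_eq]
    refine max_le hε.le ?_
    rw [abs_le]
    rcases min_cases y 1 with h | h <;> constructor <;> linarith [hx2.2]
  · rintro _ ⟨⟨x, y⟩, ⟨hx, hy⟩, rfl⟩
    simp only [mem_singleton_iff] at hy
    subst hy
    rw [hφc]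
    refine hδW ?_
    have e1 := hψ1 (x, 1)
    have e2 := hψle (x, 1)
    have e3 := hψge (x, 1) (by dsimp only; linarith)
    have e4 := hψp (x, 1)
    dsimp only at e1 e2 e3 e4 hx
    have key : ∀ q ∈ Icc (0 : ℝ) 1 ×ˢ ({0} : Set ℝ) ∪
      (({0} : Set ℝ) ×ˢ Icc (0 : ℝ) 1 ∪ ({1} : Set ℝ) ×ˢ Icc (0 : ℝ) 1),
      |x - q.1| ≤ δ → |(ψ (x, 1)).2 - q.2| ≤ δ → ψ (x, 1) ∈ Metric.cthickening δ
        (Icc (0 : ℝ) 1 ×ˢ ({0} : Set ℝ) ∪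
        (({0} : Set ℝ) ×ˢ Icc (0 : ℝ) 1 ∪ ({1} : Set ℝ) ×ˢ Icc (0 : ℝ) 1)) := by
      intro q hq h1 h2
      refine Metric.mem_cthickening_of_dist_le _ q δ _ hq ?_
      rw [Prod.dist_eq, e1, Real.dist_eq, Real.dist_eq]
      exact max_le h1 h2
    by_cases h1 : x < δ
    · refine key (0, (ψ (x, 1)).2) (Or.inr (Or.inl ⟨rfl, by linarith, e2⟩)) ?_
        (by simpa using hδ.le)
      rw [sub_zero, abs_le]; constructor <;> linarith [hx.1]
    by_cases h2 : 1 - δ < x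
    · refine key (1, (ψ (x, 1)).2) (Or.inr (Or.inr ⟨rfl, by linarith, e2⟩)) ?_
        (by simpa using hδ.le)
      rw [abs_le]; constructor <;> linarith [hx.2]
    · push Not at h1 h2
      refine key (x, 0) (Or.inl ⟨hx, rfl⟩) (by simpa using hδ.le) ?_
      rw [sub_zero, abs_le]; constructor <;> linarith [e4 ⟨h1, h2⟩ le_rfl]

end Engulfing

/-! ### Combinatorics of the square grid -/

/-- Edges of the integer grid: `(false, i, j)` joins `(i, j)` to `(i + 1, j)` and
`(true, i, j)` joins `(i, j)` to `(i, j + 1)`. -/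
abbrev Edge := Bool × ℤ × ℤ

/-- The initial vertex of an edge. -/
def Edge.src (e : Edge) : ℤ × ℤ := e.2

/-- The final vertex of an edge. -/
def Edge.tgt (e : Edge) : ℤ × ℤ := if e.1 then (e.2.1, e.2.2 + 1) else (e.2.1 + 1, e.2.2)

/-- The four sides of the unit square with lower left corner `q`. -/
def sides (q : ℤ × ℤ) : Finset Edge :=
  {(false, q.1, q.2), (false, q.1, q.2 + 1), (true, q.1, q.2), (true, q.1 + 1, q.2)}

/-- Two squares share a side. -/
def SqAdj (p q : ℤ × ℤ) : Prop :=
  (p.1 = q.1 ∧ (p.2 = q.2 + 1 ∨ q.2 = p.2 + 1)) ∨ (p.2 = q.2 ∧ (p.1 = q.1 + 1 ∨ q.1 = p.1 + 1))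

/-- Adjacency of vertices through an edge in `S`. -/
def EdgeAdj (S : Set Edge) (u v : ℤ × ℤ) : Prop :=
  ∃ e ∈ S, (u = e.src ∧ v = e.tgt) ∨ (u = e.tgt ∧ v = e.src)

/-- The boundary of a one-chain modulo two. -/
def vertexBoundary (c : Edge → ZMod 2) (w : ℤ × ℤ) : ZMod 2 :=
  c (false, w.1, w.2) + c (false, w.1 - 1, w.2) + c (true, w.1, w.2) + c (true, w.1, w.2 - 1)

theorem vertexBoundary_single (e : Edge) (w : ℤ × ℤ) :
    vertexBoundary (Pi.single e 1) w =
      (if w = e.src then 1 else 0) + if w = e.tgt then 1 else 0 := by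
  obtain ⟨b, i, j⟩ := e
  obtain ⟨x, y⟩ := w
  have hx : x - 1 = i ↔ x = i + 1 := by omega
  have hy : y - 1 = j ↔ y = j + 1 := by omega
  cases b <;> simp [vertexBoundary, Pi.single_apply, Edge.src, Edge.tgt, hx, hy]

theorem exists_chain_of_reflTransGen {S : Set Edge} {u v : ℤ × ℤ}
    (h : Relation.ReflTransGen (EdgeAdj S) u v) :
    ∃ c : Edge → ZMod 2, (Function.support c).Finite ∧ Function.support c ⊆ S ∧
      ∀ w, vertexBoundary c w = (if w = u then 1 else 0) + if w = v then 1 else 0 := by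
  induction h with
  | refl => exact ⟨0, by simp, by simp, fun w => by simp [vertexBoundary, CharTwo.add_self_eq_zero]⟩
  | @tail v w _ h ih =>
    obtain ⟨c, hf, hS, hb⟩ := ih
    obtain ⟨e, he, hvw⟩ := h
    refine ⟨c + Pi.single e 1, (hf.union (Set.finite_singleton e)).subset ?_, ?_, fun x => ?_⟩
    · refine (Function.support_add _ _).trans (union_subset_union_right _ Pi.support_single_subset)
    · refine (Function.support_add _ _).trans (union_subset hS
        (Pi.support_single_subset.trans (by simpa using he)))
    · have h1 : vertexBoundary (c + Pi.single e 1) x =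
          vertexBoundary c x + vertexBoundary (Pi.single e 1) x := by
        simp only [vertexBoundary, Pi.add_apply]; ring
      rw [h1, hb, vertexBoundary_single]
      have h2 : ∀ a : ZMod 2, a + a = 0 := CharTwo.add_self_eq_zero
      rcases hvw with ⟨rfl, rfl⟩ | ⟨rfl, rfl⟩
      · linear_combination h2 (if x = e.src then 1 else 0)
      · linear_combination h2 (if x = e.tgt then 1 else 0)

/-- A finite one-cycle bounds a two-chain which vanishes far to the right. -/
theorem exists_bounding_chain {c : Edge → ZMod 2} (hf : (Function.support c).Finite)
    (hb : ∀ w, vertexBoundary c w = 0) :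
    ∃ (T : ℤ × ℤ → ZMod 2) (N : ℤ), (∀ q, N ≤ q.1 → T q = 0) ∧
      (∀ i j, T (i - 1, j) + T (i, j) = c (true, i, j)) ∧
      ∀ i j, T (i, j) + T (i, j - 1) = c (false, i, j) := by
  have h2 : ∀ a : ZMod 2, a + a = 0 := CharTwo.add_self_eq_zero
  let X : Finset ℤ := hf.toFinset.image fun e => e.2.1
  have hX : ∀ b i j, i ∉ X → c (b, i, j) = 0 := by
    intro b i j hi
    by_contra h
    exact hi (Finset.mem_image.2 ⟨(b, i, j), by simpa using h, rfl⟩)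
  obtain ⟨N, hN⟩ := X.bddAbove
  have hcN : ∀ b i j, N < i → c (b, i, j) = 0 := fun b i j hi =>
    hX b i j fun h => absurd (hN h) (by omega)
  let T : ℤ × ℤ → ZMod 2 := fun q => ∑ x ∈ X, if q.1 < x then c (true, x, q.2) else 0
  have hT0 : ∀ q : ℤ × ℤ, N ≤ q.1 → T q = 0 := by
    intro q hq
    refine Finset.sum_eq_zero fun x hx => ?_
    rw [if_neg (by have := hN hx; omega)]
  have hV : ∀ i j, T (i - 1, j) + T (i, j) = c (true, i, j) := by
    intro i j
    simp only [T]
    rw [← Finset.sum_add_distrib]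
    have : ∀ x ∈ X, ((if i - 1 < x then c (true, x, j) else 0) +
        if i < x then c (true, x, j) else 0) = if x = i then c (true, i, j) else 0 := by
      intro x _
      rcases lt_trichotomy x i with h | rfl | h
      · rw [if_neg (by omega), if_neg (by omega), if_neg (by omega), add_zero]
      · simp
      · rw [if_pos (by omega), if_pos (by omega), if_neg (by omega), h2]
    rw [Finset.sum_congr rfl this, Finset.sum_ite_eq' X i]
    split_ifs with h
    · rfl
    · exact (hX _ _ _ h).symm
  refine ⟨T, N, hT0, hV, fun i j => ?_⟩
  have key : ∀ n : ℕ, T (N + 1 - n, j) + T (N + 1 - n, j - 1) = c (false, N + 1 - n, j) := by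
    intro n
    induction n with
    | zero =>
      rw [hT0 _ (by simp), hT0 _ (by simp), hcN _ _ _ (by simp), add_zero]
    | succ n ih =>
      have e1 := hV (N + 1 - n) j
      have e2 := hV (N + 1 - n) (j - 1)
      have e3 := hb (N + 1 - n, j)
      simp only [vertexBoundary] at e3
      have e4 : N + 1 - ((n + 1 : ℕ) : ℤ) = N + 1 - n - 1 := by push_cast; ring
      rw [e4]
      linear_combination e1 + e2 - ih + e3 - h2 (c (false, N + 1 - n - 1, j))
        - h2 (c (false, N + 1 - n, j))
  rcases le_total i (N + 1) with h | h
  · have := key (N + 1 - i).toNat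
    rwa [Int.toNat_of_nonneg (by omega), sub_sub_cancel] at this
  · rw [hT0 _ (by dsimp only; omega), hT0 _ (by dsimp only; omega), hcN _ _ _ (by omega), add_zero]

/-- In a finite filled region of the grid, a set `S` of edges connecting all vertices but
missing some edge leaves a square with exactly one missing side. -/
theorem exists_square_one_missing {G : Finset (ℤ × ℤ)} {S : Set Edge}
    (hfill : ∀ q ∉ G, ∀ N : ℤ, ∃ q', N ≤ q'.1 ∧
      Relation.ReflTransGen (fun a b => a ∉ G ∧ b ∉ G ∧ SqAdj a b) q q')
    (hSG : ∀ e ∈ S, ∃ q ∈ G, e ∈ sides q)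
    (hconn : ∀ q ∈ G, ∀ e ∈ sides q, Relation.ReflTransGen (EdgeAdj S) e.src e.tgt)
    (hmiss : ∃ q ∈ G, ∃ e ∈ sides q, e ∉ S) :
    ∃ q ∈ G, ∃ e ∈ sides q, e ∉ S ∧ ∀ e' ∈ sides q, e' ≠ e → e' ∈ S := by
  classical
  by_contra! hno
  have h2 : ∀ a : ZMod 2, a + a = 0 := CharTwo.add_self_eq_zero
  let Ms : Finset Edge := (G.biUnion sides).filter (· ∉ S)
  have hMs : ∀ e, e ∈ Ms ↔ (∃ q ∈ G, e ∈ sides q) ∧ e ∉ S := fun e => by simp [Ms]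
  let miss : ℤ × ℤ → Finset Edge := fun q => (sides q).filter (· ∉ S)
  let Ts : Finset (ℤ × ℤ) := G.filter fun q => (miss q).Nonempty
  have hTs : ∀ q ∈ Ts, 2 ≤ (miss q).card := by
    intro q hq
    obtain ⟨hq, e, he⟩ := Finset.mem_filter.1 hq
    obtain ⟨he, heS⟩ := Finset.mem_filter.1 he
    obtain ⟨e', he', hne, heS'⟩ := hno q hq e he heS
    exact Finset.one_lt_card.2 ⟨e, Finset.mem_filter.2 ⟨he, heS⟩, e',
      Finset.mem_filter.2 ⟨he', heS'⟩, hne.symm⟩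
  have hcount : ∑ q ∈ Ts, (miss q).card ≤ 2 * Ms.card := by
    have h1 : ∀ q ∈ Ts, (miss q).card = ∑ e ∈ Ms, if e ∈ sides q then 1 else 0 := by
      intro q hq
      rw [Finset.sum_boole, Nat.cast_id]
      congr 1
      ext e
      simp only [miss, Finset.mem_filter, hMs]
      constructor
      · rintro ⟨a, b⟩; exact ⟨⟨⟨q, (Finset.mem_filter.1 hq).1, a⟩, b⟩, a⟩
      · rintro ⟨⟨_, b⟩, a⟩; exact ⟨a, b⟩
    rw [Finset.sum_congr rfl h1, Finset.sum_comm, mul_comm, ← smul_eq_mul]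
    refine Finset.sum_le_card_nsmul _ _ _ fun e _ => ?_
    rw [Finset.sum_boole, Nat.cast_id]
    obtain ⟨b, i, j⟩ := e
    refine (Finset.card_le_card (t := {(i, j), if b then (i - 1, j) else (i, j - 1)}) ?_).trans
      Finset.card_le_two
    rintro ⟨x, y⟩ hq
    have := (Finset.mem_filter.1 hq).2
    cases b <;> simp [sides] at this ⊢ <;> omega
  obtain ⟨A, hA0, ⟨e₀, he₀⟩, hAq⟩ : ∃ A : Edge → ZMod 2, (∀ e, e ∉ Ms → A e = 0) ∧
      (∃ e, A e ≠ 0) ∧ ∀ q ∈ G, ∑ e ∈ Ms, (if e ∈ sides q then A e else 0) = 0 := by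
    have hside : ∀ q ∈ G, ∀ A : Edge → ZMod 2,
        ∑ e ∈ Ms, (if e ∈ sides q then A e else 0) = ∑ e ∈ miss q, A e := by
      intro q hq A
      rw [← Finset.sum_filter]
      congr 1
      ext e
      simp only [miss, Finset.mem_filter, hMs]
      constructor
      · rintro ⟨⟨_, b⟩, a⟩; exact ⟨a, b⟩
      · rintro ⟨a, b⟩; exact ⟨⟨⟨q, hq, a⟩, b⟩, a⟩
    by_cases hall : ∀ q ∈ Ts, (miss q).card = 2
    · refine ⟨fun e => if e ∈ Ms then 1 else 0, fun e he => if_neg he, ?_, fun q hq => ?_⟩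
      · obtain ⟨q, hq, e, he, heS⟩ := hmiss
        exact ⟨e, by simp [(hMs e).2 ⟨⟨q, hq, he⟩, heS⟩]⟩
      · rw [hside q hq]
        have : ∀ e ∈ miss q, (if e ∈ Ms then (1 : ZMod 2) else 0) = 1 := by
          intro e he
          obtain ⟨he, heS⟩ := Finset.mem_filter.1 he
          exact if_pos ((hMs e).2 ⟨⟨q, hq, he⟩, heS⟩)
        rw [Finset.sum_congr rfl this, Finset.sum_const]
        by_cases hne : (miss q).Nonempty
        · rw [hall q (Finset.mem_filter.2 ⟨hq, hne⟩)]; rfl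
        · rw [Finset.not_nonempty_iff_eq_empty.1 hne]; rfl
    · push Not at hall
      obtain ⟨q₀, hq₀, hne⟩ := hall
      have hlt : Ts.card < Ms.card := by
        have h3 : ∑ q ∈ Ts, 2 < ∑ q ∈ Ts, (miss q).card :=
          Finset.sum_lt_sum hTs ⟨q₀, hq₀, lt_of_le_of_ne (hTs q₀ hq₀) hne.symm⟩
        rw [Finset.sum_const, smul_eq_mul] at h3
        omega
      let L : (Ms → ZMod 2) →ₗ[ZMod 2] (Ts → ZMod 2) :=
        LinearMap.pi fun q => ∑ e : Ms, if e.1 ∈ sides q.1 then LinearMap.proj e else 0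
      obtain ⟨a, ha, hane⟩ := (Submodule.ne_bot_iff _).1
        (LinearMap.ker_ne_bot_of_finrank_lt (f := L) (by simpa using hlt))
      have hext : ∀ e : Ms, (fun e => if h : e ∈ Ms then a ⟨e, h⟩ else 0) e.1 = a e := fun e => by
        simp
      refine ⟨fun e => if h : e ∈ Ms then a ⟨e, h⟩ else 0, fun e he => dif_neg he, ?_,
        fun q hq => ?_⟩
      · obtain ⟨e, he⟩ := Function.ne_iff.1 hane
        exact ⟨e, by rw [hext e]; exact he⟩
      · by_cases hne : (miss q).Nonempty
        · have := congrFun (LinearMap.mem_ker.1 ha) ⟨q, Finset.mem_filter.2 ⟨hq, hne⟩⟩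
          rw [← Finset.sum_coe_sort Ms]
          simp only [L, LinearMap.pi_apply, LinearMap.sum_apply, Pi.zero_apply] at this
          refine Eq.trans (Finset.sum_congr rfl fun e _ => ?_) this
          split_ifs with h
          · exact hext e
          · rfl
        · rw [hside q hq, Finset.not_nonempty_iff_eq_empty.1 hne, Finset.sum_empty]
  have he₀M : e₀ ∈ Ms := by by_contra h; exact he₀ (hA0 _ h)
  obtain ⟨⟨q₀, hq₀, heq₀⟩, heS⟩ := (hMs e₀).1 he₀M
  obtain ⟨c₀, hc₀f, hc₀S, hc₀b⟩ := exists_chain_of_reflTransGen (hconn q₀ hq₀ e₀ heq₀)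
  let c : Edge → ZMod 2 := c₀ + Pi.single e₀ 1
  have hcf : (Function.support c).Finite := (hc₀f.union (Set.finite_singleton e₀)).subset
    ((Function.support_add _ _).trans (union_subset_union_right _ Pi.support_single_subset))
  have hcb : ∀ w, vertexBoundary c w = 0 := by
    intro w
    have h1 : vertexBoundary c w =
        vertexBoundary c₀ w + vertexBoundary (Pi.single e₀ 1) w := by
      simp only [c, vertexBoundary, Pi.add_apply]; ring
    rw [h1, hc₀b, vertexBoundary_single, h2]
  have hcS : ∀ e, e ∉ S → e ≠ e₀ → c e = 0 := by
    intro e he hne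
    have : c₀ e = 0 := by by_contra h; exact he (hc₀S h)
    simp [c, this, hne]
  have hce : c e₀ = 1 := by
    have : c₀ e₀ = 0 := by by_contra h; exact heS (hc₀S h)
    simp [c, this]
  have hcG : ∀ e, (∀ q ∈ G, e ∉ sides q) → c e = 0 := by
    intro e he
    refine hcS e (fun h => ?_) ?_
    · obtain ⟨q, hq, hq'⟩ := hSG e h
      exact he q hq hq'
    · rintro rfl; exact he q₀ hq₀ heq₀
  obtain ⟨T, N, hTN, hTV, hTH⟩ := exists_bounding_chain hcf hcb
  have hadd : ∀ a b : ZMod 2, a + b = 0 → a = b := by decide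
  have hstep : ∀ a b, a ∉ G → b ∉ G → SqAdj a b → T a = T b := by
    have hH : ∀ i j, (i, j) ∉ G → (i, j - 1) ∉ G → T (i, j) = T (i, j - 1) := by
      intro i j h1 h3
      refine hadd _ _ ((hTH i j).trans (hcG _ ?_))
      rintro ⟨x, y⟩ hq hs
      simp only [sides, Finset.mem_insert, Finset.mem_singleton, Prod.mk.injEq] at hs
      simp only [Bool.false_eq_true, false_and, or_false, true_and] at hs
      rcases hs with ⟨rfl, rfl⟩ | ⟨rfl, rfl⟩
      · exact h1 hq
      · exact h3 (by simpa using hq)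
    have hV : ∀ i j, (i, j) ∉ G → (i - 1, j) ∉ G → T (i - 1, j) = T (i, j) := by
      intro i j h1 h3
      refine hadd _ _ ((hTV i j).trans (hcG _ ?_))
      rintro ⟨x, y⟩ hq hs
      simp only [sides, Finset.mem_insert, Finset.mem_singleton, Prod.mk.injEq] at hs
      simp only [Bool.true_eq_false, false_and, false_or, true_and] at hs
      rcases hs with ⟨rfl, rfl⟩ | ⟨rfl, rfl⟩
      · exact h1 hq
      · exact h3 (by simpa using hq)
    rintro ⟨x, y⟩ ⟨z, w⟩ ha hb (⟨h, h' | h'⟩ | ⟨h, h' | h'⟩) <;> dsimp only at h h' <;> subst h h'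
    · simpa using hH x (w + 1) ha (by simpa using hb)
    · simpa using (hH x (y + 1) hb (by simpa using ha)).symm
    · simpa using (hV (z + 1) y ha (by simpa using hb)).symm
    · simpa using hV (x + 1) y hb (by simpa using ha)
  have hTG : ∀ q, q ∉ G → T q = 0 := by
    intro q hq
    obtain ⟨q', hq', hpath⟩ := hfill q hq N
    rw [← hTN q' hq']
    clear hq'
    induction hpath with
    | refl => rfl
    | tail _ h ih => exact ih.trans (hstep _ _ h.1 h.2.1 h.2.2)
  have hcT : ∀ e, c e = ∑ q ∈ G, if e ∈ sides q then T q else 0 := by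
    rintro ⟨b, i, j⟩
    have hsum : ∀ p p' : ℤ × ℤ, p ≠ p' → (∀ q, (b, i, j) ∈ sides q ↔ q = p ∨ q = p') →
        ∑ q ∈ G, (if (b, i, j) ∈ sides q then T q else 0) = T p + T p' := by
      intro p p' hne hiff
      have : ∀ q ∈ G, (if (b, i, j) ∈ sides q then T q else 0) =
          (if q = p then T p else 0) + if q = p' then T p' else 0 := by
        intro q _
        simp only [hiff]
        by_cases h1 : q = p
        · subst h1; simp [hne]
        · by_cases h3 : q = p'
          · subst h3; simp [h1]
          · simp [h1, h3]
      rw [Finset.sum_congr rfl this, Finset.sum_add_distrib, Finset.sum_ite_eq', Finset.sum_ite_eq']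
      congr 1
      · split_ifs with h
        · rfl
        · exact (hTG _ h).symm
      · split_ifs with h
        · rfl
        · exact (hTG _ h).symm
    cases b
    · rw [hsum (i, j) (i, j - 1) (by simp; omega) (by rintro ⟨x, y⟩; simp [sides]; omega), hTH]
    · rw [hsum (i - 1, j) (i, j) (by simp) (by rintro ⟨x, y⟩; simp [sides]; omega), hTV]
  have hzero : ∑ e ∈ Ms, A e * c e = 0 := by
    simp only [hcT, Finset.mul_sum]
    rw [Finset.sum_comm]
    refine Finset.sum_eq_zero fun q hq => ?_
    have := congrArg (T q * ·) (hAq q hq)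
    simp only [mul_zero, Finset.mul_sum] at this
    refine Eq.trans (Finset.sum_congr rfl fun e _ => ?_) this
    by_cases h : e ∈ sides q
    · rw [if_pos h, if_pos h, mul_comm]
    · rw [if_neg h, if_neg h, mul_zero, mul_zero]
  rw [Finset.sum_eq_single e₀ (fun e he hne => by rw [hcS e ((hMs e).1 he).2 hne, mul_zero])
    (fun h => absurd he₀M h), hce, mul_one] at hzero
  exact he₀ hzero

/-- The closed unit square with lower left corner `q`. -/
def gridSquare (q : ℤ × ℤ) : Set (ℝ × ℝ) := Icc (q.1 : ℝ) (q.1 + 1) ×ˢ Icc (q.2 : ℝ) (q.2 + 1)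

/-- The closed segment carried by an edge. -/
def edgeSegment (e : Edge) : Set (ℝ × ℝ) :=
  if e.1 then {(e.2.1 : ℝ)} ×ˢ Icc (e.2.2 : ℝ) (e.2.2 + 1)
  else Icc (e.2.1 : ℝ) (e.2.1 + 1) ×ˢ {(e.2.2 : ℝ)}

/-- The lattice point as a point of the plane. -/
def latticePoint (v : ℤ × ℤ) : ℝ × ℝ := (v.1, v.2)

theorem isCompact_edgeSegment (e : Edge) : IsCompact (edgeSegment e) := by
  unfold edgeSegment
  split_ifs
  · exact isCompact_singleton.prod isCompact_Icc
  · exact isCompact_Icc.prod isCompact_singleton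

theorem isCompact_gridSquare (q : ℤ × ℤ) : IsCompact (gridSquare q) :=
  isCompact_Icc.prod isCompact_Icc

theorem eq_of_lt_of_lt {i i' : ℤ} {x : ℝ} (hx : x ∈ Ioo (0 : ℝ) 1) (h1 : (i' : ℝ) ≤ i + x)
    (h2 : (i + x : ℝ) ≤ i' + 1) : i' = i := by
  have h3 : (i' : ℝ) < i + 1 := by linarith [hx.2]
  have h4 : (i : ℝ) < i' + 1 := by linarith [hx.1]
  have h3' : i' < i + 1 := by exact_mod_cast h3
  have h4' : i < i' + 1 := by exact_mod_cast h4
  omega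

theorem ne_intCast_of_mem_Ioo {i i' : ℤ} {x : ℝ} (hx : x ∈ Ioo (0 : ℝ) 1) : (i + x : ℝ) ≠ i' := by
  intro h
  obtain rfl := eq_of_lt_of_lt hx h.ge (by linarith)
  linarith [hx.1]

theorem notMem_edgeSegment_of_interior {i j : ℤ} {x y : ℝ} (hx : x ∈ Ioo (0 : ℝ) 1)
    (hy : y ∈ Ioo (0 : ℝ) 1) (e : Edge) : ((i + x, j + y) : ℝ × ℝ) ∉ edgeSegment e := by
  obtain ⟨b, i', j'⟩ := e
  cases b
  · rintro ⟨-, h⟩; exact ne_intCast_of_mem_Ioo hy h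
  · rintro ⟨h, -⟩; exact ne_intCast_of_mem_Ioo hx h

/-- The relative interior of an edge segment. -/
def openSegmentOf (e : Edge) : Set (ℝ × ℝ) :=
  if e.1 then {(e.2.1 : ℝ)} ×ˢ Ioo (e.2.2 : ℝ) (e.2.2 + 1)
  else Ioo (e.2.1 : ℝ) (e.2.1 + 1) ×ˢ {(e.2.2 : ℝ)}

theorem eq_of_mem_openSegmentOf {e e' : Edge} {p : ℝ × ℝ} (hp : p ∈ openSegmentOf e)
    (hp' : p ∈ edgeSegment e') : e' = e := by
  obtain ⟨b, i, j⟩ := e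
  obtain ⟨b', i', j'⟩ := e'
  obtain ⟨x, y⟩ := p
  cases b <;> cases b' <;> simp only [openSegmentOf, edgeSegment, Bool.false_eq_true, if_true,
    if_false, mem_prod, mem_singleton_iff, mem_Icc, mem_Ioo] at hp hp' <;> obtain ⟨h1, h2⟩ := hp
    <;> obtain ⟨h3, h4⟩ := hp'
  · have := eq_of_lt_of_lt (i := i) (i' := i') (x := x - i) ⟨by linarith, by linarith⟩
      (by linarith [h3.1])
      (by linarith [h3.2])
    have h5 : j' = j := by exact_mod_cast h4.symm.trans h2
    rw [this, h5]
  · exact absurd (by linarith) (ne_intCast_of_mem_Ioo (i := i) (i' := i') (x := x - i)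
      ⟨by linarith, by linarith⟩)
  · exact absurd (by linarith) (ne_intCast_of_mem_Ioo (i := j) (i' := j') (x := y - j)
      ⟨by linarith, by linarith⟩)
  · have := eq_of_lt_of_lt (i := j) (i' := j') (x := y - j) ⟨by linarith, by linarith⟩
      (by linarith [h4.1])
      (by linarith [h4.2])
    have h5 : i' = i := by exact_mod_cast h3.symm.trans h1
    rw [this, h5]

theorem eq_src_or_tgt_of_mem {v : ℤ × ℤ} {e : Edge} (h : latticePoint v ∈ edgeSegment e) :
    v = e.src ∨ v = e.tgt := by
  obtain ⟨b, i, j⟩ := e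
  obtain ⟨x, y⟩ := v
  cases b <;> simp [latticePoint, edgeSegment, Edge.src, Edge.tgt] at h ⊢ <;> norm_cast at h <;>
    omega

theorem src_mem_edgeSegment (e : Edge) : latticePoint e.src ∈ edgeSegment e := by
  obtain ⟨b, i, j⟩ := e
  cases b <;> simp [latticePoint, edgeSegment, Edge.src]

theorem tgt_mem_edgeSegment (e : Edge) : latticePoint e.tgt ∈ edgeSegment e := by
  obtain ⟨b, i, j⟩ := e
  cases b <;> simp [latticePoint, edgeSegment, Edge.tgt]

theorem edgeSegment_subset_gridSquare {e : Edge} {q : ℤ × ℤ} (h : e ∈ sides q) :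
    edgeSegment e ⊆ gridSquare q := by
  obtain ⟨i, j⟩ := q
  rintro ⟨x, y⟩ hp
  simp only [sides, Finset.mem_insert, Finset.mem_singleton] at h
  rcases h with rfl | rfl | rfl | rfl <;>
    simp [edgeSegment, gridSquare] at hp ⊢ <;> obtain ⟨h1, h2⟩ := hp <;> subst_vars <;>
    simp_all

theorem frontier_gridSquare_subset (q : ℤ × ℤ) :
    frontier (gridSquare q) ⊆ ⋃ e ∈ sides q, edgeSegment e := by
  obtain ⟨i, j⟩ := q
  rw [gridSquare, frontier_prod_eq, isClosed_Icc.closure_eq, isClosed_Icc.closure_eq,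
    frontier_Icc (by linarith), frontier_Icc (by linarith)]
  rintro ⟨x, y⟩ hp
  simp only [sides, Finset.mem_insert, Finset.mem_singleton, iUnion_iUnion_eq_or_left,
    iUnion_iUnion_eq_left]
  simp [edgeSegment] at hp ⊢
  tauto

section

variable {k : ℕ∞}

/-- Coordinates straightening an edge, starting from its first vertex. -/
theorem exists_isDiffeo_edge_src (e : Edge) : ∃ L : ℝ × ℝ → ℝ × ℝ, IsDiffeo 𝓘(ℝ, ℝ × ℝ) k L ∧
    L (0, 0) = latticePoint e.src ∧ L (0, 1) = latticePoint e.tgt ∧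
    L '' ({0} ×ˢ Icc 0 1) = edgeSegment e ∧ ∀ y ∈ Ioo (0 : ℝ) 1, L (0, y) ∈ openSegmentOf e := by
  obtain ⟨b, i, j⟩ := e
  cases b
  · refine ⟨fun p => (i + p.2, j + p.1), isDiffeo_of_contDiff_inverse
      (g := fun p => (p.2 - j, p.1 - i))
      (by fun_prop) (by fun_prop) (fun p => by simp) (fun p => by simp),
      by simp [latticePoint, Edge.src],
      by simp [latticePoint, Edge.tgt], ?_, ?_⟩
    · ext ⟨x, y⟩
      simp only [mem_image, mem_prod, mem_singleton_iff, mem_Icc, Prod.exists, Prod.mk.injEq,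
        edgeSegment, Bool.false_eq_true, if_false]
      constructor
      · rintro ⟨_, b, ⟨rfl, h⟩, rfl, rfl⟩; exact ⟨⟨by linarith, by linarith⟩, by ring⟩
      · rintro ⟨h, rfl⟩; exact ⟨0, x - i, ⟨rfl, by linarith, by linarith⟩, by ring, by ring⟩
    · rintro y ⟨h1, h2⟩; simp [openSegmentOf, h1, h2]
  · refine ⟨fun p => (i + p.1, j + p.2), isDiffeo_of_contDiff_inverse
      (g := fun p => (p.1 - i, p.2 - j))
      (by fun_prop) (by fun_prop) (fun p => by simp) (fun p => by simp),
      by simp [latticePoint, Edge.src],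
      by simp [latticePoint, Edge.tgt], ?_, ?_⟩
    · ext ⟨x, y⟩
      simp only [mem_image, mem_prod, mem_singleton_iff, mem_Icc, Prod.exists, Prod.mk.injEq,
        edgeSegment, if_true]
      constructor
      · rintro ⟨_, b, ⟨rfl, h⟩, rfl, rfl⟩; exact ⟨by ring, by linarith, by linarith⟩
      · rintro ⟨rfl, h⟩; exact ⟨0, y - j, ⟨rfl, by linarith, by linarith⟩, by ring, by ring⟩
    · rintro y ⟨h1, h2⟩; simp [openSegmentOf, h1, h2]

/-- Coordinates straightening an edge, starting from its last vertex. -/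
theorem exists_isDiffeo_edge_tgt (e : Edge) : ∃ L : ℝ × ℝ → ℝ × ℝ, IsDiffeo 𝓘(ℝ, ℝ × ℝ) k L ∧
    L (0, 0) = latticePoint e.tgt ∧ L (0, 1) = latticePoint e.src ∧
    L '' ({0} ×ˢ Icc 0 1) = edgeSegment e ∧ ∀ y ∈ Ioo (0 : ℝ) 1, L (0, y) ∈ openSegmentOf e := by
  obtain ⟨L, hL, h0, h1, him, ho⟩ := exists_isDiffeo_edge_src (k := k) e
  have hflip : IsDiffeo 𝓘(ℝ, ℝ × ℝ) k (fun p : ℝ × ℝ => (p.1, 1 - p.2)) :=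
    isDiffeo_of_contDiff_inverse
      (g := fun p => (p.1, 1 - p.2))
      (by fun_prop) (by fun_prop) (fun p => by simp) (fun p => by simp)
  refine ⟨_, hL.comp hflip, by simp [h1], by simp [h0], ?_, fun y hy => ?_⟩
  · rw [image_comp, ← him]
    congr 1
    ext ⟨x, y⟩
    simp only [mem_image, mem_prod, mem_singleton_iff, mem_Icc, Prod.exists, Prod.mk.injEq]
    constructor
    · rintro ⟨_, b, ⟨rfl, h⟩, rfl, rfl⟩; exact ⟨rfl, by linarith, by linarith⟩
    · rintro ⟨rfl, h⟩; exact ⟨0, 1 - y, ⟨rfl, by linarith, by linarith⟩, rfl, by ring⟩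
  · exact ho (1 - y) ⟨by linarith [hy.2], by linarith [hy.1]⟩

/-- Coordinates on a square in which a given side becomes the top side. -/
theorem exists_isDiffeo_square {q : ℤ × ℤ} {e : Edge} (he : e ∈ sides q) :
    ∃ L : ℝ × ℝ → ℝ × ℝ, IsDiffeo 𝓘(ℝ, ℝ × ℝ) k L ∧
    edgeSegment e ⊆ L '' (Icc 0 1 ×ˢ {1}) ∧
    (∀ x ∈ Icc (0 : ℝ) 1, ∃ e' ∈ sides q, e' ≠ e ∧ L (x, 0) ∈ edgeSegment e') ∧
    (∀ y ∈ Icc (0 : ℝ) 1, ∃ e' ∈ sides q, e' ≠ e ∧ L (0, y) ∈ edgeSegment e') ∧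
    (∀ y ∈ Icc (0 : ℝ) 1, ∃ e' ∈ sides q, e' ≠ e ∧ L (1, y) ∈ edgeSegment e') ∧
    ∀ x ∈ Ioo (0 : ℝ) 1, ∀ y ∈ Ioc (0 : ℝ) 1, L (x, y) ∈ gridSquare q ∧
      ∀ e', L (x, y) ∈ edgeSegment e' → e' = e := by
  obtain ⟨i, j⟩ := q
  simp only [sides, Finset.mem_insert, Finset.mem_singleton] at he
  have hr : ∀ x ∈ Ioo (0 : ℝ) 1, 1 - x ∈ Ioo (0 : ℝ) 1 := fun x hx =>
    ⟨by linarith [hx.2], by linarith [hx.1]⟩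
  rcases he with rfl | rfl | rfl | rfl
  · refine ⟨fun p => (i + p.1, j + (1 - p.2)), isDiffeo_of_contDiff_inverse
      (g := fun p => (p.1 - i, 1 - (p.2 - j)))
      (by fun_prop) (by fun_prop) (fun p => by simp) (fun p => by simp), ?_, fun x hx =>
      ⟨(false, i, j + 1), by simp [sides], by simp, by simpa [edgeSegment] using hx⟩, fun y hy =>
      ⟨(true, i, j), by simp [sides], by simp, by simpa [edgeSegment, and_comm] using hy⟩,
      fun y hy =>
      ⟨(true, i + 1, j), by simp [sides], by simp, by simpa [edgeSegment, and_comm] using hy⟩, ?_⟩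
    · rintro ⟨x, y⟩ ⟨h1, h2⟩
      exact ⟨(x - i, 1), ⟨⟨by linarith [h1.1], by linarith [h1.2]⟩, rfl⟩, by
        simp at h2; simp [h2]⟩
    · rintro x hx y hy
      refine ⟨⟨⟨by simp [hx.1.le], by simp [hx.2.le]⟩, ⟨by simp [hy.2], by simp [hy.1.le]⟩⟩,
        fun e' he' => ?_⟩
      rcases hy.2.lt_or_eq with h | rfl
      · exact absurd he' (notMem_edgeSegment_of_interior hx (hr y ⟨hy.1, h⟩) e')
      · exact eq_of_mem_openSegmentOf (by simpa [openSegmentOf] using hx) he'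
  · refine ⟨fun p => (i + p.1, j + p.2), isDiffeo_of_contDiff_inverse
      (g := fun p => (p.1 - i, p.2 - j))
      (by fun_prop) (by fun_prop) (fun p => by simp) (fun p => by simp), ?_, fun x hx =>
      ⟨(false, i, j), by simp [sides], by simp, by simpa [edgeSegment] using hx⟩, fun y hy =>
      ⟨(true, i, j), by simp [sides], by simp, by simpa [edgeSegment, and_comm] using hy⟩,
      fun y hy =>
      ⟨(true, i + 1, j), by simp [sides], by simp, by simpa [edgeSegment, and_comm] using hy⟩, ?_⟩
    · rintro ⟨x, y⟩ ⟨h1, h2⟩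
      exact ⟨(x - i, 1), ⟨⟨by linarith [h1.1], by linarith [h1.2]⟩, rfl⟩, by
        simp at h2; simp [h2]⟩
    · rintro x hx y hy
      refine ⟨⟨⟨by simp [hx.1.le], by simp [hx.2.le]⟩, ⟨by simp [hy.1.le], by simp [hy.2]⟩⟩,
        fun e' he' => ?_⟩
      rcases hy.2.lt_or_eq with h | rfl
      · exact absurd he' (notMem_edgeSegment_of_interior hx ⟨hy.1, h⟩ e')
      · exact eq_of_mem_openSegmentOf (by simpa [openSegmentOf] using hx) he'
  · refine ⟨fun p => (i + (1 - p.2), j + p.1), isDiffeo_of_contDiff_inverse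
      (g := fun p => (p.2 - j, 1 - (p.1 - i)))
      (by fun_prop) (by fun_prop) (fun p => by simp) (fun p => by simp), ?_, fun x hx =>
      ⟨(true, i + 1, j), by simp [sides], by simp, by simpa [edgeSegment] using hx⟩, fun y hy =>
      ⟨(false, i, j), by simp [sides], by simp, by simpa [edgeSegment, and_comm] using hy⟩,
      fun y hy =>
      ⟨(false, i, j + 1), by simp [sides], by simp, by simpa [edgeSegment, and_comm] using hy⟩, ?_⟩
    · rintro ⟨x, y⟩ ⟨h2, h1⟩
      exact ⟨(y - j, 1), ⟨⟨by linarith [h1.1], by linarith [h1.2]⟩, rfl⟩, by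
        simp at h2; simp [h2]⟩
    · rintro x hx y hy
      refine ⟨⟨⟨by simp [hy.2], by simp [hy.1.le]⟩, ⟨by simp [hx.1.le], by simp [hx.2.le]⟩⟩,
        fun e' he' => ?_⟩
      rcases hy.2.lt_or_eq with h | rfl
      · exact absurd he' (notMem_edgeSegment_of_interior (hr y ⟨hy.1, h⟩) hx e')
      · exact eq_of_mem_openSegmentOf (by simpa [openSegmentOf] using hx) he'
  · refine ⟨fun p => (i + p.2, j + p.1), isDiffeo_of_contDiff_inverse
      (g := fun p => (p.2 - j, p.1 - i))
      (by fun_prop) (by fun_prop) (fun p => by simp) (fun p => by simp), ?_, fun x hx =>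
      ⟨(true, i, j), by simp [sides], by simp, by simpa [edgeSegment] using hx⟩, fun y hy =>
      ⟨(false, i, j), by simp [sides], by simp, by simpa [edgeSegment, and_comm] using hy⟩,
      fun y hy =>
      ⟨(false, i, j + 1), by simp [sides], by simp, by simpa [edgeSegment, and_comm] using hy⟩, ?_⟩
    · rintro ⟨x, y⟩ ⟨h2, h1⟩
      exact ⟨(y - j, 1), ⟨⟨by linarith [h1.1], by linarith [h1.2]⟩, rfl⟩, by
        simp at h2; simp [h2]⟩
    · rintro x hx y hy
      refine ⟨⟨⟨by simp [hy.1.le], by simp [hy.2]⟩, ⟨by simp [hx.1.le], by simp [hx.2.le]⟩⟩,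
        fun e' he' => ?_⟩
      rcases hy.2.lt_or_eq with h | rfl
      · exact absurd he' (notMem_edgeSegment_of_interior ⟨hy.1, h⟩ hx e')
      · exact eq_of_mem_openSegmentOf (by simpa [openSegmentOf] using hx) he'

end

theorem exists_step_of_reflTransGen {α : Type*} {r : α → α → Prop} {p : α → Prop} {a b : α}
    (h : Relation.ReflTransGen r a b) (ha : p a) (hb : ¬ p b) : ∃ x y, r x y ∧ p x ∧ ¬ p y := by
  induction h with
  | refl => exact absurd ha hb
  | @tail c d _ h ih =>
    by_cases hc : p c
    · exact ⟨c, d, h, hc, hb⟩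
    · exact ih hc

/-- `v` is an endpoint of an edge in `S`. -/
def IsVertexOf (S : Set Edge) (v : ℤ × ℤ) : Prop := ∃ e ∈ S, v = e.src ∨ v = e.tgt

theorem EdgeAdj.mono {S S' : Set Edge} (h : S ⊆ S') {u v : ℤ × ℤ} (huv : EdgeAdj S u v) :
    EdgeAdj S' u v :=
  let ⟨e, he, h'⟩ := huv; ⟨e, h he, h'⟩

theorem edgeAdj_symm (S : Set Edge) : Std.Symm (EdgeAdj S) :=
  ⟨fun _ _ ⟨e, he, h⟩ => ⟨e, he, h.elim (fun h => .inr ⟨h.2, h.1⟩) fun h => .inl ⟨h.2, h.1⟩⟩⟩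

theorem IsVertexOf.exists_mem_edgeSegment {S : Set Edge} {v : ℤ × ℤ} (h : IsVertexOf S v) :
    ∃ e ∈ S, latticePoint v ∈ edgeSegment e := by
  obtain ⟨e, he, rfl | rfl⟩ := h
  exacts [⟨e, he, src_mem_edgeSegment e⟩, ⟨e, he, tgt_mem_edgeSegment e⟩]

section GridEngulfing

variable {E H M : Type*} [NormedAddCommGroup E] [NormedSpace ℝ E] [TopologicalSpace H]
  {I : ModelWithCorners ℝ E H} [TopologicalSpace M] [ChartedSpace H M] {k : ℕ∞}

/-- An open topological plane engulfs a finite filled union of coordinate grid squares,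
keeping `A` fixed, provided it contains a connected set of squares among them and `A` misses the
remaining ones. -/
theorem IsPar.engulfs_grid [T2Space M] (hk : 1 ≤ k) (h : M ≃ₜ ℝ × ℝ) {c : ℝ × ℝ → M}
    (hc : IsPar I k c) {A W : Set M} (hW : IsOpen W) (hWp : Nonempty (W ≃ₜ ℝ × ℝ))
    (hA : IsClosed A) {P G : Finset (ℤ × ℤ)}
    (hfill : ∀ q ∉ G, ∀ N : ℤ, ∃ q', N ≤ q'.1 ∧
      Relation.ReflTransGen (fun a b => a ∉ G ∧ b ∉ G ∧ SqAdj a b) q q')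
    (hPG : P ⊆ G) {v₀ : ℤ × ℤ} (hv₀ : IsVertexOf {e | ∃ q ∈ P, e ∈ sides q} v₀)
    (hP : ∀ v, IsVertexOf {e | ∃ q ∈ P, e ∈ sides q} v →
      Relation.ReflTransGen (EdgeAdj {e | ∃ q ∈ P, e ∈ sides q}) v₀ v)
    (hG : ∀ v, IsVertexOf {e | ∃ q ∈ G, e ∈ sides q} v →
      Relation.ReflTransGen (EdgeAdj {e | ∃ q ∈ G, e ∈ sides q}) v₀ v)
    (hPW : ∀ q ∈ P, c '' gridSquare q ⊆ W) (hGA : ∀ q ∈ G, q ∉ P → Disjoint (c '' gridSquare q) A) :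
    Engulfs I k A W (c '' ⋃ q ∈ G, gridSquare q) := by
  classical
  have hcc := hc.continuous
  suffices key : ∀ (n : ℕ) (S : Finset Edge), (∀ e ∈ S, ∃ q ∈ G, e ∈ sides q) →
      (∀ q ∈ P, ∀ e ∈ sides q, e ∈ S) →
      (∀ v, IsVertexOf (S : Set Edge) v → Relation.ReflTransGen (EdgeAdj (S : Set Edge)) v₀ v) →
      Engulfs I k A W (c '' ⋃ e ∈ S, edgeSegment e) → ((G.biUnion sides) \ S).card = n →
      Engulfs I k A W (c '' ⋃ q ∈ G, gridSquare q) by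
    have hS : ((P.biUnion sides : Finset Edge) : Set Edge) = {e | ∃ q ∈ P, e ∈ sides q} := by
      ext e; simp
    refine key _ (P.biUnion sides) (fun e he => ?_) (fun q hq e he => ?_) ?_ ?_ rfl
    · obtain ⟨q, hq, he⟩ := Finset.mem_biUnion.1 he
      exact ⟨q, hPG hq, he⟩
    · exact Finset.mem_biUnion.2 ⟨q, hq, he⟩
    · rw [hS]; exact hP
    · refine ⟨id, .id, fun _ _ => rfl, ?_⟩
      rintro _ ⟨p, hp, rfl⟩
      simp only [mem_iUnion, exists_prop] at hp
      obtain ⟨e, he, hp⟩ := hp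
      obtain ⟨q, hq, he⟩ := Finset.mem_biUnion.1 he
      exact hPW q hq ⟨p, edgeSegment_subset_gridSquare he hp, rfl⟩
  intro n
  induction n with
  | zero =>
    rintro S - - - ⟨φ, hφ, hφA, hφS⟩ hn
    have hsub : G.biUnion sides ⊆ S := by
      rwa [Finset.card_eq_zero, Finset.sdiff_eq_empty_iff_subset] at hn
    refine ⟨φ, hφ, hφA, ?_⟩
    rintro _ ⟨p, hp, rfl⟩
    simp only [mem_iUnion, exists_prop] at hp
    obtain ⟨q, hq, hp⟩ := hp
    refine image_subset_of_image_frontier_subset h (W := φ ⁻¹' W)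
      (hWp.map fun e => (hφ.toHomeomorph.sets (s := φ ⁻¹' W) (t := W) rfl).trans e)
      hc.isOpenEmbedding (isCompact_gridSquare q) ?_ ⟨p, hp, rfl⟩
    rintro _ ⟨p', hp', rfl⟩
    have := frontier_gridSquare_subset q hp'
    simp only [mem_iUnion, exists_prop] at this
    obtain ⟨e, he, hp''⟩ := this
    refine hφS ⟨p', ?_, rfl⟩
    simp only [mem_iUnion, exists_prop]
    exact ⟨e, hsub (Finset.mem_biUnion.2 ⟨q, hq, he⟩), hp''⟩
  | succ n ih =>
    rintro S hSG hPS hS ⟨φ, hφ, hφA, hφS⟩ hn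
    have hSW : ∀ e ∈ S, ∀ p ∈ edgeSegment e, φ (c p) ∈ W := by
      intro e he p hp
      refine hφS ⟨p, ?_, rfl⟩
      simp only [mem_iUnion, exists_prop]
      exact ⟨e, he, hp⟩
    let B : Set M := A ∪ c '' ⋃ e ∈ S, edgeSegment e
    have hB : IsClosed B :=
      hA.union ((S.isCompact_biUnion fun e _ => isCompact_edgeSegment e).image hcc).isClosed
    have hcB : ∀ p, c p ∈ B → c p ∈ A ∨ ∃ e ∈ S, p ∈ edgeSegment e := by
      rintro p (hp | ⟨p', hp', hpp⟩)
      · exact .inl hp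
      · rw [hc.2 hpp] at hp'
        simp only [mem_iUnion, exists_prop] at hp'
        exact .inr hp'
    have hW' : IsOpen (φ ⁻¹' W) := hW.preimage hφ.continuous
    have hadd : ∀ e, (∃ q ∈ G, e ∈ sides q) → e ∉ S →
        (∀ v, IsVertexOf ((insert e S : Finset Edge) : Set Edge) v →
          Relation.ReflTransGen (EdgeAdj ((insert e S : Finset Edge) : Set Edge)) v₀ v) →
        Engulfs I k B (φ ⁻¹' W) (c '' edgeSegment e) →
        Engulfs I k A W (c '' ⋃ q ∈ G, gridSquare q) := by
      rintro e heG heS hconn ⟨φ', hφ', hφB, hφe⟩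
      refine ih (insert e S) ?_ ?_ hconn ⟨φ ∘ φ', hφ.comp hφ', ?_, ?_⟩ ?_
      · intro e' he'
        rcases Finset.mem_insert.1 he' with rfl | he'
        exacts [heG, hSG e' he']
      · exact fun q hq e' he' => Finset.mem_insert_of_mem (hPS q hq e' he')
      · intro x hx
        rw [Function.comp_apply, hφB x (.inl hx), hφA x hx]
      · rintro _ ⟨p, hp, rfl⟩
        simp only [mem_iUnion, exists_prop] at hp
        obtain ⟨e', he', hp⟩ := hp
        rcases Finset.mem_insert.1 he' with rfl | he'
        · exact hφe ⟨p, hp, rfl⟩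
        · rw [Function.comp_apply, hφB]
          · exact hSW e' he' p hp
          · refine .inr ⟨p, ?_, rfl⟩
            simp only [mem_iUnion, exists_prop]
            exact ⟨e', he', hp⟩
      · have h1 : e ∈ G.biUnion sides \ S :=
          Finset.mem_sdiff.2 ⟨Finset.mem_biUnion.2 heG, heS⟩
        rw [Finset.sdiff_insert, Finset.card_erase_of_mem h1, hn]
        rfl
    have hmono : ∀ e, ∀ u v, EdgeAdj (S : Set Edge) u v →
        EdgeAdj ((insert e S : Finset Edge) : Set Edge) u v := fun e u v huv =>
      huv.mono (by simp)
    by_cases hV : ∀ v, IsVertexOf {e | ∃ q ∈ G, e ∈ sides q} v → IsVertexOf (S : Set Edge) v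
    · -- all vertices are reached: complete a square with exactly one missing side
      have := edgeAdj_symm (S : Set Edge)
      obtain ⟨q, hq, e, he, heS, huniq⟩ := exists_square_one_missing (S := (S : Set Edge)) hfill hSG
        (fun q hq e he => ((Relation.ReflTransGen.stdSymm (r := EdgeAdj (S : Set Edge))).symm _ _
          (hS _ (hV _ ⟨e, ⟨q, hq, he⟩, .inl rfl⟩))).trans
            (hS _ (hV _ ⟨e, ⟨q, hq, he⟩, .inr rfl⟩))) (by
          obtain ⟨e, he⟩ := Finset.card_pos.1 (by rw [hn]; exact n.succ_pos)
          obtain ⟨he, heS⟩ := Finset.mem_sdiff.1 he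
          obtain ⟨q, hq, he⟩ := Finset.mem_biUnion.1 he
          exact ⟨q, hq, e, he, heS⟩)
      have hqP : q ∉ P := fun hqP => heS (hPS q hqP e he)
      refine hadd e ⟨q, hq, he⟩ heS (fun v hv => ?_) ?_
      · have hv' : IsVertexOf (S : Set Edge) v := by
          obtain ⟨e', he', hv⟩ := hv
          rcases Finset.mem_insert.1 he' with rfl | he'
          · exact hV v ⟨e', ⟨q, hq, he⟩, hv⟩
          · exact ⟨e', he', hv⟩
        exact Relation.ReflTransGen.mono (hmono e) _ _ (hS v hv')
      · obtain ⟨L, hL, htop, hbot, hleft, hright, hint⟩ := exists_isDiffeo_square (k := k) he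
        obtain ⟨φ', hφ', hφB, hφe⟩ := (hc.comp_isDiffeo hL).engulfs_top hk (B := B) hW' hB
          (fun x hx => let ⟨e', he', hne, hp⟩ := hbot x hx; hSW e' (huniq e' he' hne) _ hp)
          (fun x hx => let ⟨e', he', hne, hp⟩ := hleft x hx; hSW e' (huniq e' he' hne) _ hp)
          (fun x hx => let ⟨e', he', hne, hp⟩ := hright x hx; hSW e' (huniq e' he' hne) _ hp)
          (fun x hx y hy hxy => by
            obtain ⟨h1, h2⟩ := hint x hx y hy
            rcases hcB _ hxy with h3 | ⟨e', he', h3⟩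
            · exact (hGA q hq hqP).le_bot ⟨⟨_, h1, rfl⟩, h3⟩
            · exact heS (h2 e' h3 ▸ he'))
        refine ⟨φ', hφ', hφB, hφe.mono_left ?_⟩
        rw [image_comp]
        exact image_mono htop
    · -- some vertex is not reached yet: add an edge leading to a new vertex
      push Not at hV
      obtain ⟨u, huG, huS⟩ := hV
      have hv₀S : IsVertexOf (S : Set Edge) v₀ := by
        obtain ⟨e, ⟨q, hq, he⟩, hv⟩ := hv₀
        exact ⟨e, hPS q hq e he, hv⟩
      obtain ⟨x, y, ⟨e, ⟨q, hq, he⟩, hxy⟩, hx, hy⟩ :=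
        exists_step_of_reflTransGen (p := IsVertexOf (S : Set Edge)) (hG u huG) hv₀S huS
      have heS : e ∉ S := fun heS => hy ⟨e, heS, hxy.elim (fun h => .inr h.2) fun h => .inl h.2⟩
      have hqP : q ∉ P := fun hqP => heS (hPS q hqP e he)
      refine hadd e ⟨q, hq, he⟩ heS (fun v hv => ?_) ?_
      · have hx' := Relation.ReflTransGen.mono (hmono e) _ _ (hS x hx)
        have hve : v = x ∨ v = y ∨ IsVertexOf (S : Set Edge) v := by
          obtain ⟨e', he', hv⟩ := hv
          rcases Finset.mem_insert.1 he' with rfl | he'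
          · rcases hxy with ⟨rfl, rfl⟩ | ⟨rfl, rfl⟩ <;> tauto
          · exact .inr (.inr ⟨e', he', hv⟩)
        rcases hve with rfl | rfl | hv
        · exact hx'
        · exact hx'.tail ⟨e, Finset.mem_insert_self _ _, hxy⟩
        · exact Relation.ReflTransGen.mono (hmono e) _ _ (hS v hv)
      · obtain ⟨L, hL, h0, h1, him, ho⟩ : ∃ L : ℝ × ℝ → ℝ × ℝ, IsDiffeo 𝓘(ℝ, ℝ × ℝ) k L ∧
            L (0, 0) = latticePoint x ∧ L (0, 1) = latticePoint y ∧
            L '' ({0} ×ˢ Icc 0 1) = edgeSegment e ∧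
            ∀ y ∈ Ioo (0 : ℝ) 1, L (0, y) ∈ openSegmentOf e := by
          rcases hxy with ⟨rfl, rfl⟩ | ⟨rfl, rfl⟩
          exacts [exists_isDiffeo_edge_src e, exists_isDiffeo_edge_tgt e]
        have := (hc.comp_isDiffeo hL).engulfs_segment hk (B := B) hW' hB (by
          obtain ⟨e', he', hp⟩ := hx.exists_mem_edgeSegment
          rw [Function.comp_apply, h0]
          exact hSW e' he' _ hp) (fun t ht hB => by
            rcases hcB _ hB with h3 | ⟨e', he', h3⟩
            · refine (hGA q hq hqP).le_bot ⟨⟨_, edgeSegment_subset_gridSquare he ?_, rfl⟩, h3⟩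
              rw [← him]
              exact ⟨(0, t), ⟨rfl, ht.1.le, ht.2⟩, rfl⟩
            · rcases ht.2.lt_or_eq with h4 | rfl
              · exact heS (eq_of_mem_openSegmentOf (ho t ⟨ht.1, h4⟩) h3 ▸ he')
              · rw [h1] at h3
                exact hy ⟨e', he', eq_src_or_tgt_of_mem h3⟩)
        rwa [image_comp, him] at this

end GridEngulfing

/-! ### Choosing the squares to be engulfed -/

/-- Two squares share a corner. -/
def CornerAdj (a b : ℤ × ℤ) : Prop := |a.1 - b.1| ≤ 1 ∧ |a.2 - b.2| ≤ 1

theorem CornerAdj.refl (a : ℤ × ℤ) : CornerAdj a a := by simp [CornerAdj]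

theorem CornerAdj.symm {a b : ℤ × ℤ} (h : CornerAdj a b) : CornerAdj b a :=
  ⟨abs_sub_comm a.1 b.1 ▸ h.1, abs_sub_comm a.2 b.2 ▸ h.2⟩

/-- Corner adjacency within a set of squares. -/
def CornerAdjIn (G : Set (ℤ × ℤ)) (a b : ℤ × ℤ) : Prop := a ∈ G ∧ b ∈ G ∧ CornerAdj a b

theorem cornerAdjIn_symm (G : Set (ℤ × ℤ)) : Std.Symm (CornerAdjIn G) :=
  ⟨fun _ _ h => ⟨h.2.1, h.1, h.2.2.symm⟩⟩

theorem cornerAdjIn_reflTransGen_symm {G : Set (ℤ × ℤ)} {a b : ℤ × ℤ}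
    (h : Relation.ReflTransGen (CornerAdjIn G) a b) :
    Relation.ReflTransGen (CornerAdjIn G) b a :=
  have := cornerAdjIn_symm G
  (Relation.ReflTransGen.stdSymm (r := CornerAdjIn G)).symm _ _ h

theorem CornerAdjIn.mono {G G' : Set (ℤ × ℤ)} (hG : G ⊆ G') {a b : ℤ × ℤ}
    (h : Relation.ReflTransGen (CornerAdjIn G) a b) :
    Relation.ReflTransGen (CornerAdjIn G') a b :=
  Relation.ReflTransGen.mono (fun _ _ h => ⟨hG h.1, hG h.2.1, h.2.2⟩) _ _ h

/-- Side adjacency outside a set of squares. -/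
def SideAdjOff (Z : Set (ℤ × ℤ)) (a b : ℤ × ℤ) : Prop := a ∉ Z ∧ b ∉ Z ∧ SqAdj a b

theorem sideAdjOff_symm {Z : Set (ℤ × ℤ)} {a b : ℤ × ℤ} (h : SideAdjOff Z a b) :
    SideAdjOff Z b a :=
  ⟨h.2.1, h.1, by have := h.2.2; unfold SqAdj at *; omega⟩

/-- The square `q` can be joined to squares arbitrarily far to the right, avoiding `Z`. -/
def IsFar (Z : Set (ℤ × ℤ)) (q : ℤ × ℤ) : Prop :=
  ∀ N : ℤ, ∃ q', N ≤ q'.1 ∧ Relation.ReflTransGen (SideAdjOff Z) q q'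

theorem IsFar.of_reflTransGen {Z : Set (ℤ × ℤ)} {q q' : ℤ × ℤ}
    (h : Relation.ReflTransGen (SideAdjOff Z) q q') (hq' : IsFar Z q') : IsFar Z q := fun N =>
  let ⟨p, hp, hpath⟩ := hq' N; ⟨p, hp, h.trans hpath⟩

theorem IsFar.notMem {Z : Set (ℤ × ℤ)} {q : ℤ × ℤ} (h : IsFar Z q) : q ∉ Z := by
  intro hq
  obtain ⟨q', hq', hpath⟩ := h (q.1 + 1)
  rcases Relation.ReflTransGen.cases_head hpath with rfl | ⟨_, h, -⟩
  · omega
  · exact h.1 hq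

theorem IsFar.of_forall_right {Z : Set (ℤ × ℤ)} {q : ℤ × ℤ}
    (h : ∀ n : ℕ, (q.1 + n, q.2) ∉ Z) : IsFar Z q := by
  have key : ∀ n : ℕ, Relation.ReflTransGen (SideAdjOff Z) q (q.1 + n, q.2) := by
    intro n
    induction n with
    | zero => simpa using Relation.ReflTransGen.refl
    | succ n ih =>
      refine ih.tail ⟨h n, h (n + 1), .inr ⟨rfl, .inr (by push_cast; ring)⟩⟩
  intro N
  exact ⟨_, by have := Int.self_le_toNat (N - q.1); dsimp only; omega, key (N - q.1).toNat⟩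

theorem isFar_of_notMem_box {Z : Set (ℤ × ℤ)} {n : ℤ} (hZ : ∀ q ∈ Z, |q.1| ≤ n ∧ |q.2| ≤ n)
    {q : ℤ × ℤ} (hq : ¬ (|q.1| ≤ n ∧ |q.2| ≤ n)) : IsFar Z q := by
  have hZ' : ∀ p : ℤ × ℤ, ¬ (|p.1| ≤ n ∧ |p.2| ≤ n) → p ∉ Z := fun p hp h => hp (hZ p h)
  have hrow : ∀ p : ℤ × ℤ, n < |p.2| → IsFar Z p := fun p hp =>
    .of_forall_right fun i => hZ' _ (by dsimp only; omega)
  by_cases h2 : n < |q.2|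
  · exact hrow q h2
  by_cases h1 : n < q.1
  · refine .of_forall_right fun i => hZ' _ fun h => ?_
    have := abs_le.1 h.1
    dsimp only at this; omega
  have hq1 : ¬ |q.1| ≤ n := fun h => hq ⟨h, not_lt.1 h2⟩
  have key : ∀ i : ℕ, Relation.ReflTransGen (SideAdjOff Z) q (q.1, q.2 + i) := by
    intro i
    induction i with
    | zero => simpa using Relation.ReflTransGen.refl
    | succ i ih =>
      refine ih.tail ⟨hZ' _ fun h => hq1 h.1, hZ' _ fun h => hq1 h.1,
        .inl ⟨rfl, .inr (by push_cast; ring)⟩⟩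
  refine (hrow _ ?_).of_reflTransGen (key (2 * n + 1).toNat)
  have := abs_le.1 (not_lt.1 h2)
  have h3 := Int.self_le_toNat (2 * n + 1)
  exact lt_of_lt_of_le (by dsimp only; omega) (le_abs_self _)

theorem isVertexOf_sides_iff {q v : ℤ × ℤ} : IsVertexOf (sides q : Set Edge) v ↔
    (v.1 = q.1 ∨ v.1 = q.1 + 1) ∧ (v.2 = q.2 ∨ v.2 = q.2 + 1) := by
  obtain ⟨x, y⟩ := v
  obtain ⟨i, j⟩ := q
  simp [IsVertexOf, sides, Edge.src, Edge.tgt]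
  omega

/-- The edges of a corner-connected family of squares form a connected graph. -/
theorem reflTransGen_edgeAdj {G : Set (ℤ × ℤ)} {a b u v : ℤ × ℤ} (ha : a ∈ G)
    (h : Relation.ReflTransGen (CornerAdjIn G) a b) (hu : IsVertexOf (sides a : Set Edge) u)
    (hv : IsVertexOf (sides b : Set Edge) v) :
    Relation.ReflTransGen (EdgeAdj {e | ∃ q ∈ G, e ∈ sides q}) u v := by
  have hsq : ∀ q ∈ G, ∀ u v, IsVertexOf (sides q : Set Edge) u → IsVertexOf (sides q : Set Edge) v →
      Relation.ReflTransGen (EdgeAdj {e | ∃ q ∈ G, e ∈ sides q}) u v := by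
    intro q hq u v hu hv
    have hH : ∀ y, (y = q.2 ∨ y = q.2 + 1) →
        EdgeAdj {e | ∃ q ∈ G, e ∈ sides q} (q.1, y) (q.1 + 1, y) := fun y hy =>
      ⟨(false, q.1, y), ⟨q, hq, by simp [sides]; tauto⟩, .inl ⟨rfl, rfl⟩⟩
    have hV : ∀ x, (x = q.1 ∨ x = q.1 + 1) →
        EdgeAdj {e | ∃ q ∈ G, e ∈ sides q} (x, q.2) (x, q.2 + 1) := fun x hx =>
      ⟨(true, x, q.2), ⟨q, hq, by simpa [sides, Prod.ext_iff] using hx⟩, .inl ⟨rfl, rfl⟩⟩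
    have hs := (edgeAdj_symm {e | ∃ q ∈ G, e ∈ sides q}).symm
    have h1 : ∀ x y x', (x = q.1 ∨ x = q.1 + 1) → (x' = q.1 ∨ x' = q.1 + 1) →
        (y = q.2 ∨ y = q.2 + 1) →
        Relation.ReflTransGen (EdgeAdj {e | ∃ q ∈ G, e ∈ sides q}) (x, y) (x', y) := by
      rintro x y x' (rfl | rfl) (rfl | rfl) hy
      exacts [.refl, .single (hH y hy), .single (hs _ _ (hH y hy)), .refl]
    have h2 : ∀ x y y', (x = q.1 ∨ x = q.1 + 1) → (y = q.2 ∨ y = q.2 + 1) →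
        (y' = q.2 ∨ y' = q.2 + 1) →
        Relation.ReflTransGen (EdgeAdj {e | ∃ q ∈ G, e ∈ sides q}) (x, y) (x, y') := by
      rintro x y y' hx (rfl | rfl) (rfl | rfl)
      exacts [.refl, .single (hV x hx), .single (hs _ _ (hV x hx)), .refl]
    rw [isVertexOf_sides_iff] at hu hv
    exact (h1 u.1 u.2 v.1 hu.1 hv.1 hu.2).trans (h2 v.1 u.2 v.2 hv.1 hu.2 hv.2)
  induction h generalizing v with
  | refl => exact hsq a ha u v hu hv
  | @tail b b' _ h ih =>
    have hw : IsVertexOf (sides b : Set Edge) (max b.1 b'.1, max b.2 b'.2) ∧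
        IsVertexOf (sides b' : Set Edge) (max b.1 b'.1, max b.2 b'.2) := by
      have h1 := abs_le.1 h.2.2.1
      have h2 := abs_le.1 h.2.2.2
      simp only [isVertexOf_sides_iff]
      omega
    exact (ih hw.1).trans (hsq b' h.2.1 _ _ hw.2 hv)

/-- Given the squares `D` met by a set and a corner-connected family `Q` of squares in a box, there
is a finite filled family of squares containing `Q`, whose squares in `D` form a connected
family. -/
theorem exists_filled_squares {D : Set (ℤ × ℤ)} {Q : Set (ℤ × ℤ)} {n : ℤ} {s : ℤ × ℤ}
    (hsD : s ∈ D) (hsQ : s ∈ Q) (hQ : ∀ q ∈ Q, |q.1| ≤ n ∧ |q.2| ≤ n)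
    (hQc : ∀ q ∈ Q, Relation.ReflTransGen (CornerAdjIn Q) s q)
    (hnear : ∀ q ∈ D, ∀ t ∈ Q, CornerAdj q t →
      Relation.ReflTransGen (CornerAdjIn {q ∈ D | |q.1| ≤ n ∧ |q.2| ≤ n}) s q)
    (hD : ∀ F ⊆ D, F.Finite → F.Nonempty → (∀ a ∈ F, ∀ b ∈ D, CornerAdj a b → b ∈ F) → s ∈ F) :
    ∃ P G : Finset (ℤ × ℤ), (∀ q ∉ G, ∀ N : ℤ, ∃ q', N ≤ q'.1 ∧
        Relation.ReflTransGen (fun a b => a ∉ G ∧ b ∉ G ∧ SqAdj a b) q q') ∧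
      P ⊆ G ∧ s ∈ P ∧ Q ⊆ G ∧ (∀ q ∈ P, q ∈ D ∧ |q.1| ≤ n ∧ |q.2| ≤ n) ∧
      (∀ q ∈ P, Relation.ReflTransGen (CornerAdjIn P) s q) ∧
      (∀ q ∈ G, Relation.ReflTransGen (CornerAdjIn G) s q) ∧
      ∀ q ∈ G, q ∉ P → q ∉ D := by
  classical
  let X : Set (ℤ × ℤ) := {q | |q.1| ≤ n ∧ |q.2| ≤ n}
  let DX : Set (ℤ × ℤ) := {q ∈ D | |q.1| ≤ n ∧ |q.2| ≤ n}
  have hX : X.Finite := ((Set.finite_Icc (-n) n).prod (Set.finite_Icc (-n) n)).subset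
    fun q hq => ⟨abs_le.1 hq.1, abs_le.1 hq.2⟩
  let P : Set (ℤ × ℤ) := {q | Relation.ReflTransGen (CornerAdjIn DX) s q}
  have hsX : s ∈ DX := ⟨hsD, hQ s hsQ⟩
  have hPX : P ⊆ DX := fun q hq => by
    rcases Relation.ReflTransGen.cases_tail hq with rfl | ⟨_, -, h⟩
    exacts [hsX, h.2.1]
  let Z : Set (ℤ × ℤ) := P ∪ Q
  have hZX : ∀ q ∈ Z, |q.1| ≤ n ∧ |q.2| ≤ n := fun q hq => hq.elim (fun h => (hPX h).2) (hQ q)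
  let G : Set (ℤ × ℤ) := {q | ¬ IsFar Z q}
  have hGX : G ⊆ X := fun q hq => by
    by_contra h
    exact hq (isFar_of_notMem_box hZX h)
  have hZG : Z ⊆ G := fun q hq h => h.notMem hq
  have hPfin : P.Finite := hX.subset fun q hq => (hPX hq).2
  have hGfin : G.Finite := hX.subset hGX
  refine ⟨hPfin.toFinset, hGfin.toFinset, ?_, ?_, ?_, ?_, ?_, ?_, ?_, ?_⟩
  · intro q hq N
    simp only [Finite.mem_toFinset] at hq ⊢
    replace hq : IsFar Z q := not_not.1 hq
    obtain ⟨q', hq', hpath⟩ := hq N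
    refine ⟨q', hq', ?_⟩
    clear hq'
    induction hpath with
    | refl => exact .refl
    | @tail a b hqa hab ih =>
      refine ih.tail ?_
      have : Std.Symm (SideAdjOff Z) := ⟨fun _ _ => sideAdjOff_symm⟩
      have hfar : ∀ {a}, Relation.ReflTransGen (SideAdjOff Z) q a → IsFar Z a := fun h =>
        hq.of_reflTransGen
          ((Relation.ReflTransGen.stdSymm (r := SideAdjOff Z)).symm _ _ h)
      exact ⟨fun h => h (hfar hqa), fun h => h (hfar (hqa.tail hab)), hab.2.2⟩
  · exact fun q hq => hGfin.mem_toFinset.2 (hZG (.inl (hPfin.mem_toFinset.1 hq)))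
  · simpa using (show s ∈ P from .refl)
  · exact fun q hq => hGfin.mem_toFinset.2 (hZG (.inr hq))
  · exact fun q hq => hPX (hPfin.mem_toFinset.1 hq)
  · simp only [Finite.mem_toFinset, Finite.coe_toFinset]
    intro q hq
    have hq' : Relation.ReflTransGen (CornerAdjIn DX) s q := hq
    clear hq
    induction hq' with
    | refl => exact .refl
    | @tail a b ha hab ih => exact ih.tail ⟨ha, ha.tail hab, hab.2.2⟩
  · simp only [Finite.mem_toFinset, Finite.coe_toFinset]
    have hZc : ∀ q ∈ Z, Relation.ReflTransGen (CornerAdjIn G) s q := by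
      rintro q (hq | hq)
      · have hq' : Relation.ReflTransGen (CornerAdjIn DX) s q := hq
        clear hq
        induction hq' with
        | refl => exact .refl
        | @tail a b ha hab ih =>
          exact ih.tail ⟨hZG (.inl ha), hZG (.inl (ha.tail hab)), hab.2.2⟩
      · exact CornerAdjIn.mono (fun x hx => hZG (.inr hx)) (hQc q hq)
    intro q hq
    obtain ⟨i, hi⟩ : ∃ i : ℕ, (q.1 + i, q.2) ∈ Z := by
      by_contra! h
      exact hq (.of_forall_right h)
    induction i generalizing q with
    | zero => exact hZc q (by simpa using hi)
    | succ i ih =>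
      by_cases hqZ : q ∈ Z
      · exact hZc q hqZ
      have hadj : CornerAdj (q.1 + 1, q.2) q := by simp [CornerAdj]
      have hG' : (q.1 + 1, q.2) ∈ G := by
        by_cases hZ' : (q.1 + 1, q.2) ∈ Z
        · exact hZG hZ'
        · exact fun hf => hq (hf.of_reflTransGen (.single ⟨hqZ, hZ', by simp [SqAdj]⟩))
      refine (ih _ hG' ?_).tail ⟨hG', hq, hadj⟩
      convert hi using 2
      push_cast; ring
  · simp only [Finite.mem_toFinset]
    intro q hq hqP hqD
    have hqX : q ∈ DX := ⟨hqD, hGX hq⟩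
    let F : Set (ℤ × ℤ) := {a | Relation.ReflTransGen (CornerAdjIn DX) q a}
    have hFX : F ⊆ DX := fun a ha => by
      rcases Relation.ReflTransGen.cases_tail ha with rfl | ⟨_, -, h⟩
      exacts [hqX, h.2.1]
    have hFP : ∀ a ∈ F, a ∉ P := fun a ha haP =>
      hqP (haP.trans (cornerAdjIn_reflTransGen_symm ha))
    have hFZ : ∀ a ∈ F, ∀ t, CornerAdj a t → t ∉ Z := by
      rintro a ha t hat (ht | ht)
      · exact hFP a ha (Relation.ReflTransGen.tail ht ⟨hPX ht, hFX ha, hat.symm⟩)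
      · exact hFP a ha (hnear a (hFX ha).1 t ht hat)
    have hstep : ∀ a ∈ F, ∀ b, CornerAdj a b → Relation.ReflTransGen (SideAdjOff Z) a b := by
      intro a ha b hab
      have h1 : CornerAdj a (a.1, b.2) := ⟨by simp, hab.2⟩
      have h2 := abs_le.1 hab.1
      have h3 := abs_le.1 hab.2
      refine Relation.ReflTransGen.trans (b := (a.1, b.2)) ?_ ?_
      · by_cases h : a.2 = b.2
        · rw [← h]
        · exact .single ⟨hFZ a ha a (.refl a), hFZ a ha _ h1, by simp only [SqAdj, true_and]; omega⟩
      · by_cases h : a.1 = b.1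
        · rw [h]
        · exact .single ⟨hFZ a ha _ h1, hFZ a ha _ hab, by simp only [SqAdj, true_and]; omega⟩
    have hpath : ∀ a ∈ F, Relation.ReflTransGen (SideAdjOff Z) q a := by
      intro a ha
      have ha' : Relation.ReflTransGen (CornerAdjIn DX) q a := ha
      clear ha
      induction ha' with
      | refl => exact .refl
      | @tail a b ha hab ih => exact ih.trans (hstep a ha b hab.2.2)
    refine hFP s (hD F (fun a ha => (hFX ha).1) (hX.subset fun a ha => (hFX ha).2) ⟨q, .refl⟩ ?_)
      .refl
    intro a ha b hb hab
    by_cases hbX : |b.1| ≤ n ∧ |b.2| ≤ n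
    · exact Relation.ReflTransGen.tail ha ⟨hFX ha, ⟨hb, hbX⟩, hab⟩
    · exact absurd ((isFar_of_notMem_box hZX hbX).of_reflTransGen
        ((hpath a ha).trans (hstep a ha b hab))) hq

/-- The lower left corner of a grid square containing `p`. -/
def squareOf (p : ℝ × ℝ) : ℤ × ℤ := (⌊p.1⌋, ⌊p.2⌋)

theorem mem_gridSquare_squareOf (p : ℝ × ℝ) : p ∈ gridSquare (squareOf p) :=
  ⟨⟨Int.floor_le _, (Int.lt_floor_add_one _).le⟩, ⟨Int.floor_le _, (Int.lt_floor_add_one _).le⟩⟩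

theorem CornerAdj.of_mem {a b : ℤ × ℤ} {p : ℝ × ℝ} (ha : p ∈ gridSquare a) (hb : p ∈ gridSquare b) :
    CornerAdj a b := by
  obtain ⟨⟨h1, h2⟩, h3, h4⟩ := ha
  obtain ⟨⟨h5, h6⟩, h7, h8⟩ := hb
  have e1 : a.1 ≤ b.1 + 1 := by exact_mod_cast h1.trans h6
  have e2 : b.1 ≤ a.1 + 1 := by exact_mod_cast h5.trans h2
  have e3 : a.2 ≤ b.2 + 1 := by exact_mod_cast h3.trans h8
  have e4 : b.2 ≤ a.2 + 1 := by exact_mod_cast h7.trans h4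
  exact ⟨abs_le.2 (by omega), abs_le.2 (by omega)⟩

theorem CornerAdj.dist_le {a b : ℤ × ℤ} (h : CornerAdj a b) {x y : ℝ × ℝ} (hx : x ∈ gridSquare a)
    (hy : y ∈ gridSquare b) : dist x y ≤ 2 := by
  obtain ⟨⟨h1, h2⟩, h3, h4⟩ := hx
  obtain ⟨⟨h5, h6⟩, h7, h8⟩ := hy
  have h9 := abs_le.1 h.1
  have h10 := abs_le.1 h.2
  have e1 : (a.1 : ℝ) ≤ b.1 + 1 := by exact_mod_cast (by omega : a.1 ≤ b.1 + 1)
  have e2 : (b.1 : ℝ) ≤ a.1 + 1 := by exact_mod_cast (by omega : b.1 ≤ a.1 + 1)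
  have e3 : (a.2 : ℝ) ≤ b.2 + 1 := by exact_mod_cast (by omega : a.2 ≤ b.2 + 1)
  have e4 : (b.2 : ℝ) ≤ a.2 + 1 := by exact_mod_cast (by omega : b.2 ≤ a.2 + 1)
  rw [Prod.dist_eq, max_le_iff, Real.dist_eq, Real.dist_eq, abs_le, abs_le]
  constructor <;> constructor <;> linarith

/-- The squares met by `T`. -/
def squaresMeeting (T : Set (ℝ × ℝ)) : Set (ℤ × ℤ) := {q | (gridSquare q ∩ T).Nonempty}

theorem abs_le_of_mem_squaresMeeting {T : Set (ℝ × ℝ)} {n : ℤ}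
    (hT : T ⊆ Metric.closedBall 0 (n - 1)) {q : ℤ × ℤ} (hq : q ∈ squaresMeeting T) :
    |q.1| ≤ n ∧ |q.2| ≤ n := by
  obtain ⟨p, ⟨⟨h1, h2⟩, h3, h4⟩, hp⟩ := hq
  have h5 := hT hp
  rw [mem_closedBall_zero_iff, Prod.norm_def, max_le_iff, Real.norm_eq_abs, Real.norm_eq_abs,
    abs_le, abs_le] at h5
  have e1 : (q.1 : ℝ) ≤ n := by linarith
  have e2 : (-n : ℝ) ≤ q.1 := by linarith
  have e3 : (q.2 : ℝ) ≤ n := by linarith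
  have e4 : (-n : ℝ) ≤ q.2 := by linarith
  exact ⟨abs_le.2 ⟨by exact_mod_cast e2, by exact_mod_cast e1⟩,
    abs_le.2 ⟨by exact_mod_cast e4, by exact_mod_cast e3⟩⟩

theorem finite_box (n : ℤ) : {q : ℤ × ℤ | |q.1| ≤ n ∧ |q.2| ≤ n}.Finite :=
  ((Set.finite_Icc (-n) n).prod (Set.finite_Icc (-n) n)).subset
    fun _ hq => ⟨abs_le.1 hq.1, abs_le.1 hq.2⟩

theorem isClosed_biUnion_gridSquare {S : Set (ℤ × ℤ)} (hS : S.Finite) :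
    IsClosed (⋃ q ∈ S, gridSquare q) :=
  hS.isClosed_biUnion fun q _ => (isCompact_gridSquare q).isClosed

/-- The squares met by a connected bounded set form a corner-connected family. -/
theorem cornerConnected_squaresMeeting {T : Set (ℝ × ℝ)} (hT : IsPreconnected T) {n : ℤ}
    (hTn : T ⊆ Metric.closedBall 0 (n - 1)) {s q : ℤ × ℤ} (hs : s ∈ squaresMeeting T)
    (hq : q ∈ squaresMeeting T) :
    Relation.ReflTransGen (CornerAdjIn (squaresMeeting T)) s q := by
  by_contra hcon
  have hfin : (squaresMeeting T).Finite :=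
    (finite_box n).subset fun q hq => abs_le_of_mem_squaresMeeting hTn hq
  let S : Set (ℤ × ℤ) := {a ∈ squaresMeeting T |
    Relation.ReflTransGen (CornerAdjIn (squaresMeeting T)) s a}
  let S' : Set (ℤ × ℤ) := {a ∈ squaresMeeting T |
    ¬ Relation.ReflTransGen (CornerAdjIn (squaresMeeting T)) s a}
  have hcover : T ⊆ (⋃ a ∈ S, gridSquare a) ∪ ⋃ a ∈ S', gridSquare a := by
    intro p hp
    have h1 : squareOf p ∈ squaresMeeting T := ⟨p, mem_gridSquare_squareOf p, hp⟩
    by_cases h : Relation.ReflTransGen (CornerAdjIn (squaresMeeting T)) s (squareOf p)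
    · exact .inl (mem_biUnion (show squareOf p ∈ S from ⟨h1, h⟩) (mem_gridSquare_squareOf p))
    · exact .inr (mem_biUnion (show squareOf p ∈ S' from ⟨h1, h⟩) (mem_gridSquare_squareOf p))
  obtain ⟨x, hx, hxT⟩ := hs
  obtain ⟨y, hy, hyT⟩ := hq
  obtain ⟨p, hpT, hp, hp'⟩ := isPreconnected_closed_iff.1 hT _ _
    (isClosed_biUnion_gridSquare (S := S) (hfin.subset fun a ha => ha.1))
    (isClosed_biUnion_gridSquare (S := S') (hfin.subset fun a ha => ha.1)) hcover
    ⟨x, hxT, mem_biUnion (show s ∈ S from ⟨⟨x, hx, hxT⟩, .refl⟩) hx⟩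
    ⟨y, hyT, mem_biUnion (show q ∈ S' from ⟨⟨y, hy, hyT⟩, hcon⟩) hy⟩
  simp only [mem_iUnion, exists_prop] at hp hp'
  obtain ⟨a, ha, hpa⟩ := hp
  obtain ⟨b, hb, hpb⟩ := hp'
  exact hb.2 (ha.2.tail ⟨ha.1, hb.1, .of_mem hpa hpb⟩)

section UnitMesh

variable {E H M : Type*} [NormedAddCommGroup E] [NormedSpace ℝ E] [TopologicalSpace H]
  {I : ModelWithCorners ℝ E H} [TopologicalSpace M] [ChartedSpace H M] {k : ℕ∞}

/-- A finite family of squares meeting a connected set `A` which is isolated among the squares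
meeting `A` covers `A`. -/
theorem subset_image_of_isolated [T2Space M] {c : ℝ × ℝ → M} (hc : IsOpenEmbedding c) {A : Set M}
    (hA : IsPreconnected A) {F : Set (ℤ × ℤ)} (hF : F.Finite) (hFA : F ⊆ squaresMeeting (c ⁻¹' A))
    (hne : F.Nonempty) (hiso : ∀ a ∈ F, ∀ b ∈ squaresMeeting (c ⁻¹' A), CornerAdj a b → b ∈ F) :
    A ⊆ c '' ⋃ a ∈ F, gridSquare a := by
  let O : Set (ℝ × ℝ) := ⋃ a ∈ F,
    Ioo ((a.1 : ℝ) - 1) (a.1 + 2) ×ˢ Ioo ((a.2 : ℝ) - 1) (a.2 + 2)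
  have hO : IsOpen O := isOpen_biUnion fun a _ => isOpen_Ioo.prod isOpen_Ioo
  have hOA : ∀ p ∈ O, c p ∈ A → p ∈ ⋃ a ∈ F, gridSquare a := by
    intro p hp hpA
    simp only [O, mem_iUnion, exists_prop] at hp
    obtain ⟨a, ha, ⟨h1, h2⟩, h3, h4⟩ := hp
    refine mem_biUnion (x := squareOf p) (hiso a ha _ ⟨p, mem_gridSquare_squareOf p, hpA⟩ ?_)
      (mem_gridSquare_squareOf p)
    have e1 : ((a.1 - 1 : ℤ) : ℝ) ≤ p.1 := by push_cast; exact h1.le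
    have e2 : p.1 < ((a.1 + 2 : ℤ) : ℝ) := by push_cast; exact h2
    have e3 : ((a.2 - 1 : ℤ) : ℝ) ≤ p.2 := by push_cast; exact h3.le
    have e4 : p.2 < ((a.2 + 2 : ℤ) : ℝ) := by push_cast; exact h4
    have e1 := Int.le_floor.2 e1
    have e2 := Int.floor_lt.2 e2
    have e3 := Int.le_floor.2 e3
    have e4 := Int.floor_lt.2 e4
    exact ⟨abs_le.2 (by dsimp only [squareOf]; omega), abs_le.2 (by dsimp only [squareOf]; omega)⟩
  have hFO : (⋃ a ∈ F, gridSquare a) ⊆ O := by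
    refine biUnion_mono subset_rfl fun a _ => prod_mono ?_ ?_ <;> intro x hx <;>
      exact ⟨by linarith [hx.1], by linarith [hx.2]⟩
  have hclosed : IsClosed (c '' ⋃ a ∈ F, gridSquare a) :=
    ((hF.isCompact_biUnion fun q _ => isCompact_gridSquare q).image hc.continuous).isClosed
  by_contra hcon
  obtain ⟨y, hyA, hy⟩ := not_subset.1 hcon
  have hout : ∀ y ∈ A, y ∉ c '' (⋃ a ∈ F, gridSquare a) → y ∈ (c '' O)ᶜ := by
    rintro _ hyA hy ⟨p, hp, rfl⟩
    exact hy ⟨p, hOA p hp hyA, rfl⟩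
  obtain ⟨a, ha⟩ := hne
  obtain ⟨x, hxa, hxA⟩ := hFA ha
  obtain ⟨z, hzA, hz, hz'⟩ := isPreconnected_closed_iff.1 hA _ _ hclosed
    (hc.isOpenMap _ hO).isClosed_compl
    (fun y hy => (em (y ∈ c '' ⋃ a ∈ F, gridSquare a)).imp id (hout y hy))
    ⟨c x, hxA, x, mem_biUnion ha hxa, rfl⟩ ⟨y, hyA, hout y hyA hy⟩
  exact hz' (image_mono hFO hz)

/-- The engulfing step when the unit grid is fine enough. -/
theorem IsPar.engulfs_of_unit_mesh [T2Space M] (hk : 1 ≤ k) (h : M ≃ₜ ℝ × ℝ) {c : ℝ × ℝ → M}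
    (hc : IsPar I k c) {A W : Set M} (hW : IsOpen W) (hWp : Nonempty (W ≃ₜ ℝ × ℝ))
    (hA : IsClosed A) (hAc : IsPreconnected A) {T Q : Set (ℝ × ℝ)} (hT : IsPreconnected T)
    (hQ : IsPreconnected Q) (hTA : ∀ p ∈ T, c p ∈ A) (hTQ : (T ∩ Q).Nonempty) {n : ℤ}
    (hTn : T ⊆ Metric.closedBall 0 (n - 1)) (hQn : Q ⊆ Metric.closedBall 0 (n - 1))
    (hnear : ∀ x, c x ∈ A → ∀ y ∈ Q, dist x y ≤ 2 → x ∈ T)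
    (hAW : ∀ x ∈ Metric.closedBall (0 : ℝ × ℝ) (n + 1), c x ∈ A → ∀ y, dist y x ≤ 2 → c y ∈ W) :
    Engulfs I k A W (c '' Q) := by
  obtain ⟨p₀, hpT, hpQ⟩ := hTQ
  have hs : ∀ {S : Set (ℝ × ℝ)}, p₀ ∈ S → squareOf p₀ ∈ squaresMeeting S := fun hS =>
    ⟨p₀, mem_gridSquare_squareOf p₀, hS⟩
  have hTD : squaresMeeting T ⊆ squaresMeeting (c ⁻¹' A) := fun q ⟨p, hp, hpT⟩ =>
    ⟨p, hp, hTA p hpT⟩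
  have hTD' : squaresMeeting T ⊆ {q ∈ squaresMeeting (c ⁻¹' A) | |q.1| ≤ n ∧ |q.2| ≤ n} :=
    fun q hq => ⟨hTD hq, abs_le_of_mem_squaresMeeting hTn hq⟩
  obtain ⟨P, G, hfill, hPG, hsP, hQG, hPD, hPc, hGc, hGP⟩ :=
    exists_filled_squares (D := squaresMeeting (c ⁻¹' A)) (Q := squaresMeeting Q) (n := n)
      (hTD (hs hpT)) (hs hpQ) (fun q hq => abs_le_of_mem_squaresMeeting hQn hq)
      (fun q hq => cornerConnected_squaresMeeting hQ hQn (hs hpQ) hq)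
      (by
        rintro q ⟨x, hxq, hxA⟩ t ⟨y, hyt, hyQ⟩ hqt
        refine CornerAdjIn.mono hTD' (cornerConnected_squaresMeeting hT hTn (hs hpT) ?_)
        exact ⟨x, hxq, hnear x hxA y hyQ (hqt.dist_le hxq hyt)⟩)
      (by
        intro F hFD hF hne hiso
        obtain ⟨p, hp, hpp⟩ :=
          subset_image_of_isolated hc.isOpenEmbedding hAc hF hFD hne hiso (hTA p₀ hpT)
        rw [hc.2 hpp] at hp
        simp only [mem_iUnion, exists_prop] at hp
        obtain ⟨a, ha, hpa⟩ := hp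
        exact hiso a ha _ (hTD (hs hpT)) (.of_mem hpa (mem_gridSquare_squareOf p₀)))
  obtain ⟨v₀, hv₀⟩ : ∃ v₀, IsVertexOf (sides (squareOf p₀) : Set Edge) v₀ :=
    ⟨_, isVertexOf_sides_iff.2 ⟨.inl rfl, .inl rfl⟩⟩
  have hgrid : Engulfs I k A W (c '' ⋃ q ∈ G, gridSquare q) := by
    refine hc.engulfs_grid hk h hW hWp hA hfill hPG (v₀ := v₀) ?_ ?_ ?_ ?_ ?_
    · obtain ⟨e, he, h⟩ := hv₀
      exact ⟨e, ⟨_, hsP, he⟩, h⟩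
    · rintro v ⟨e, ⟨q, hq, he⟩, hv⟩
      exact reflTransGen_edgeAdj (G := (P : Set (ℤ × ℤ))) hsP (hPc q hq) hv₀ ⟨e, he, hv⟩
    · rintro v ⟨e, ⟨q, hq, he⟩, hv⟩
      exact reflTransGen_edgeAdj (G := (G : Set (ℤ × ℤ))) (hPG hsP) (hGc q hq) hv₀ ⟨e, he, hv⟩
    · rintro q hq _ ⟨y, hy, rfl⟩
      obtain ⟨⟨x, hxq, hxA⟩, h1, h2⟩ := hPD q hq
      refine hAW x ?_ hxA y ((CornerAdj.refl q).dist_le hy hxq)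
      rw [abs_le] at h1 h2
      have e1 : (q.1 : ℝ) ≤ n := by exact_mod_cast h1.2
      have e2 : (-n : ℝ) ≤ q.1 := by exact_mod_cast h1.1
      have e3 : (q.2 : ℝ) ≤ n := by exact_mod_cast h2.2
      have e4 : (-n : ℝ) ≤ q.2 := by exact_mod_cast h2.1
      obtain ⟨⟨h1, h2⟩, h3, h4⟩ := hxq
      rw [mem_closedBall_zero_iff, Prod.norm_def, max_le_iff, Real.norm_eq_abs, Real.norm_eq_abs,
        abs_le, abs_le]
      exact ⟨⟨by linarith, by linarith⟩, by linarith, by linarith⟩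
    · intro q hq hqP
      rw [Set.disjoint_left]
      rintro _ ⟨x, hx, rfl⟩ hxA
      exact hGP q hq hqP ⟨x, hx, hxA⟩
  obtain ⟨φ, hφ, hφA, hφG⟩ := hgrid
  refine ⟨φ, hφ, hφA, hφG.mono_left (image_mono fun p hp => ?_)⟩
  exact mem_biUnion (show squareOf p ∈ (G : Set (ℤ × ℤ)) from
    hQG ⟨p, mem_gridSquare_squareOf p, hp⟩) (mem_gridSquare_squareOf p)

/-- The engulfing step: an open topological plane containing a connected compact set `A` can
be pulled over a connected compact set `Q` lying in one chart, keeping `A` fixed. -/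
theorem IsPar.engulfs [T2Space M] (hk : 1 ≤ k) (h : M ≃ₜ ℝ × ℝ) {c : ℝ × ℝ → M}
    (hc : IsPar I k c) {A W : Set M} (hW : IsOpen W) (hWp : Nonempty (W ≃ₜ ℝ × ℝ))
    (hA : IsCompact A) (hAc : IsPreconnected A) (hAW : A ⊆ W) {T Q O : Set M}
    (hT : IsCompact T) (hTc : IsPreconnected T) (hQ : IsCompact Q) (hQc : IsPreconnected Q)
    (hTr : T ⊆ range c) (hQr : Q ⊆ range c) (hTA : T ⊆ A) (hTQ : (T ∩ Q).Nonempty)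
    (hO : IsOpen O) (hQO : Q ⊆ O) (hAO : A ∩ O ⊆ T) : Engulfs I k A W Q := by
  have hcc := hc.continuous
  have hemb := hc.isOpenEmbedding
  have hT' : IsCompact (c ⁻¹' T) := hemb.isInducing.isCompact_preimage' hT hTr
  have hQ' : IsCompact (c ⁻¹' Q) := hemb.isInducing.isCompact_preimage' hQ hQr
  have hTc' : IsPreconnected (c ⁻¹' T) := hTc.preimage_of_isOpenMap hc.2 hemb.isOpenMap hTr
  have hQc' : IsPreconnected (c ⁻¹' Q) := hQc.preimage_of_isOpenMap hc.2 hemb.isOpenMap hQr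
  obtain ⟨R, hR⟩ := (hT'.union hQ').isBounded.subset_closedBall (0 : ℝ × ℝ)
  obtain ⟨δ₁, hδ₁, hδO⟩ := hQ'.exists_cthickening_subset_open (hO.preimage hcc)
    (preimage_mono hQO)
  have hA' : IsCompact (c ⁻¹' A ∩ Metric.closedBall 0 (R + 3)) :=
    (isCompact_closedBall _ _).inter_left (hA.isClosed.preimage hcc)
  obtain ⟨δ₂, hδ₂, hδW⟩ := hA'.exists_cthickening_subset_open (hW.preimage hcc)
    (inter_subset_left.trans (preimage_mono hAW))
  obtain ⟨ε, hε, hε1, hε₁, hε₂⟩ : ∃ ε : ℝ, 0 < ε ∧ ε ≤ 1 ∧ 2 * ε ≤ δ₁ ∧ 2 * ε ≤ δ₂ := by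
    refine ⟨min 1 (min δ₁ δ₂ / 2), by positivity, min_le_left _ _, ?_, ?_⟩
    · linarith [min_le_right 1 (min δ₁ δ₂ / 2), min_le_left δ₁ δ₂]
    · linarith [min_le_right 1 (min δ₁ δ₂ / 2), min_le_right δ₁ δ₂]
  have hs : IsDiffeo 𝓘(ℝ, ℝ × ℝ) k (fun p : ℝ × ℝ => ε • p) :=
    isDiffeo_of_contDiff_inverse
      (g := fun p => ε⁻¹ • p) (by fun_prop) (by fun_prop)
      (fun p => by simp [smul_smul, hε.ne']) (fun p => by simp [smul_smul, hε.ne'])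
  have hd : ∀ x y : ℝ × ℝ, dist (ε • x) (ε • y) = ε * dist x y := fun x y => by
    rw [dist_smul₀, Real.norm_eq_abs, abs_of_pos hε]
  have hpre : ∀ S : Set (ℝ × ℝ), (fun p : ℝ × ℝ => ε • p) ⁻¹' S =
      (fun p : ℝ × ℝ => ε⁻¹ • p) '' S := fun S => by
    ext p
    constructor
    · exact fun hp => ⟨_, hp, by simp [smul_smul, hε.ne']⟩
    · rintro ⟨p, hp, rfl⟩
      simpa [smul_smul, hε.ne'] using hp
  have hconn : ∀ {S : Set (ℝ × ℝ)}, IsPreconnected S →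
      IsPreconnected ((fun p : ℝ × ℝ => ε • p) ⁻¹' S) := fun hS => by
    rw [hpre]; exact hS.image _ (by fun_prop)
  have hTQ' : (c ⁻¹' T ∩ c ⁻¹' Q).Nonempty := by
    obtain ⟨x, hxT, hxQ⟩ := hTQ
    obtain ⟨p, rfl⟩ := hTr hxT
    exact ⟨p, hxT, hxQ⟩
  have hR0 : 0 ≤ R := by
    obtain ⟨p, hp, -⟩ := hTQ'
    exact (norm_nonneg p).trans (mem_closedBall_zero_iff.1 (hR (.inl hp)))
  let m : ℤ := ⌈ε⁻¹ * R⌉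
  have hm1 : R ≤ ε * m := by
    have := Int.le_ceil (ε⁻¹ * R)
    rwa [inv_mul_le_iff₀ hε] at this
  have hm2 : ε * (m - 1) ≤ R := by
    have := (Int.ceil_lt_add_one (ε⁻¹ * R)).le
    calc ε * (m - 1) ≤ ε * (ε⁻¹ * R) := by gcongr; linarith
      _ = R := mul_inv_cancel_left₀ hε.ne' R
  have hball : ∀ {S : Set (ℝ × ℝ)}, S ⊆ Metric.closedBall 0 R →
      (fun p : ℝ × ℝ => ε • p) ⁻¹' S ⊆ Metric.closedBall 0 (((m + 1 : ℤ) : ℝ) - 1) := by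
    intro S hS p hp
    have := mem_closedBall_zero_iff.1 (hS hp)
    dsimp only at this
    rw [norm_smul, Real.norm_eq_abs, abs_of_pos hε] at this
    rw [mem_closedBall_zero_iff]
    push_cast
    rw [add_sub_cancel_right]
    exact le_of_mul_le_mul_left (this.trans hm1) hε
  have key := (hc.comp_isDiffeo hs).engulfs_of_unit_mesh hk h (n := m + 1) hW hWp hA.isClosed hAc
    (hconn hTc') (hconn hQc') (fun p hp => hTA hp) (by
      obtain ⟨p, hp⟩ := hTQ'
      exact ⟨ε⁻¹ • p, by simpa [smul_smul, hε.ne'] using hp⟩)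
    (hball (subset_union_left.trans hR)) (hball (subset_union_right.trans hR))
    (fun x hx y hy hxy => hAO ⟨hx, hδO (Metric.mem_cthickening_of_dist_le _ _ _ _ hy (by
      rw [hd]; nlinarith))⟩)
    (fun x hx hxA y hy => hδW (Metric.mem_cthickening_of_dist_le _ _ _ _ ⟨hxA, by
      rw [mem_closedBall_zero_iff] at hx ⊢
      rw [norm_smul, Real.norm_eq_abs, abs_of_pos hε]
      push_cast at hx
      nlinarith⟩ (by rw [hd]; nlinarith)))
  obtain ⟨φ, hφ, hφA, hφQ⟩ := key
  refine ⟨φ, hφ, hφA, fun x hx => hφQ ?_⟩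
  obtain ⟨p, rfl⟩ := hQr hx
  exact ⟨ε⁻¹ • p, by simpa [smul_smul, hε.ne'] using hx, by simp [smul_smul, hε.ne']⟩

end UnitMesh

theorem interval_gluing {p : ℝ → ℝ → Prop} {a b η : ℝ} (hab : a ≤ b) (hη : 0 < η)
    (hmono : ∀ {x y x' y'}, p x y → x ≤ x' → y' ≤ y → p x' y')
    (hglue : ∀ {x y' y z}, x ≤ y' → y' < y → y ≤ z → p x y → p y' z → p x z)
    (hloc : ∀ x ∈ Icc a b, p x (x + η)) : p a b := by
  have key : ∀ n : ℕ, a + n * (η / 2) ≤ b → p a (a + (n + 2) * (η / 2)) := by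
    intro n
    induction n with
    | zero =>
      intro _
      have := hloc a ⟨le_rfl, hab⟩
      convert this using 1
      push_cast; ring
    | succ n ih =>
      intro hn
      push_cast at hn ⊢
      have h0 : (0 : ℝ) ≤ n * (η / 2) := by positivity
      refine hglue (y' := a + (n + 1) * (η / 2)) (by linarith) (by linarith) (by linarith)
        (ih (by linarith)) ?_
      have := hloc (a + (n + 1) * (η / 2)) ⟨by linarith, hn⟩
      convert this using 1
      ring
  have h0 : 0 ≤ (b - a) / (η / 2) := by have := sub_nonneg.2 hab; positivity
  refine hmono (key ⌊(b - a) / (η / 2)⌋₊ ?_) le_rfl ?_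
  · have := Nat.floor_le h0
    rw [le_div_iff₀ (by positivity)] at this
    linarith
  · have := (Nat.lt_floor_add_one ((b - a) / (η / 2))).le
    rw [div_le_iff₀ (by positivity)] at this
    linarith

section Rectangles

variable {E H M : Type*} [NormedAddCommGroup E] [NormedSpace ℝ E] [TopologicalSpace H]
  {I : ModelWithCorners ℝ E H} [TopologicalSpace M] [ChartedSpace H M] {k : ℕ∞}

theorem IsPar.isOpen_range {c : ℝ × ℝ → M} (hc : IsPar I k c) : IsOpen (range c) :=
  hc.isOpenEmbedding.isOpen_range

theorem IsPar.nonempty_homeomorph_range {c : ℝ × ℝ → M} (hc : IsPar I k c) :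
    Nonempty (range c ≃ₜ ℝ × ℝ) :=
  ⟨hc.isOpenEmbedding.toIsEmbedding.toHomeomorph.symm⟩

theorem IsPar.exists_glue [T2Space M] (hk : 1 ≤ k) (h : M ≃ₜ ℝ × ℝ) {c c' : ℝ × ℝ → M}
    (hc : IsPar I k c) (hc' : IsPar I k c') {A T Q O : Set M}
    (hA : IsCompact A) (hAc : IsPreconnected A) (hAr : A ⊆ range c)
    (hT : IsCompact T) (hTc : IsPreconnected T) (hQ : IsCompact Q) (hQc : IsPreconnected Q)
    (hTr : T ⊆ range c') (hQr : Q ⊆ range c') (hTA : T ⊆ A) (hTQ : (T ∩ Q).Nonempty)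
    (hO : IsOpen O) (hQO : Q ⊆ O) (hAO : A ∩ O ⊆ T) :
    ∃ φ : M → M, IsDiffeo I k φ ∧ (∀ x ∈ A, φ x = x) ∧ Q ⊆ range (φ ∘ c) := by
  obtain ⟨φ, hφ, hφA, hφQ⟩ := hc'.engulfs hk h hc.isOpen_range hc.nonempty_homeomorph_range hA hAc
    hAr hT hTc hQ hQc hTr hQr hTA hTQ hO hQO hAO
  obtain ⟨ψ, hψ, hψφ, -⟩ := hφ.exists_inverse
  refine ⟨ψ, hψ, fun x hx => ?_, fun x hx => ?_⟩
  · have := hψφ x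
    rwa [hφA x hx] at this
  · obtain ⟨p, hp⟩ := hφQ hx
    exact ⟨p, by rw [Function.comp_apply, hp, hψφ x]⟩

/-- The rectangle `[a, b] × [c, d]`, transported by `h`, lies in a single chart domain. -/
def RectangleInChart (I : ModelWithCorners ℝ E H) (k : ℕ∞) (h : M ≃ₜ ℝ × ℝ) (a b c d : ℝ) : Prop :=
  ∃ χ : ℝ × ℝ → M, IsPar I k χ ∧ h ⁻¹' (Icc a b ×ˢ Icc c d) ⊆ range χ

theorem RectangleInChart.mono {h : M ≃ₜ ℝ × ℝ} {a b c d a' b' c' d' : ℝ}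
    (hR : RectangleInChart I k h a b c d) (ha : a ≤ a') (hb : b' ≤ b) (hc : c ≤ c') (hd : d' ≤ d) :
    RectangleInChart I k h a' b' c' d' :=
  let ⟨χ, hχ, hs⟩ := hR
  ⟨χ, hχ, (preimage_mono (prod_mono (Icc_subset_Icc ha hb) (Icc_subset_Icc hc hd))).trans hs⟩

theorem rectangleInChart_swap {h : M ≃ₜ ℝ × ℝ} {a b c d : ℝ} :
    RectangleInChart I k (h.trans (Homeomorph.prodComm ℝ ℝ)) c d a b ↔
      RectangleInChart I k h a b c d := by
  have : (h.trans (Homeomorph.prodComm ℝ ℝ)) ⁻¹' (Icc c d ×ˢ Icc a b) =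
      h ⁻¹' (Icc a b ×ˢ Icc c d) := by
    ext x; simp
  rw [RectangleInChart, RectangleInChart, this]

theorem RectangleInChart.glue [T2Space M] (hk : 1 ≤ k) {h : M ≃ₜ ℝ × ℝ} {a b' b e c d : ℝ}
    (hab : a ≤ b') (hb : b' < b) (hbe : b ≤ e) (hcd : c ≤ d)
    (h1 : RectangleInChart I k h a b c d) (h2 : RectangleInChart I k h b' e c d) :
    RectangleInChart I k h a e c d := by
  obtain ⟨χ, hχ, hs⟩ := h1
  obtain ⟨χ', hχ', hs'⟩ := h2
  have hcomp : ∀ x y, IsCompact (h ⁻¹' (Icc x y ×ˢ Icc c d)) := fun x y =>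
    h.isCompact_preimage.2 (isCompact_Icc.prod isCompact_Icc)
  have hconn : ∀ x y, IsPreconnected (h ⁻¹' (Icc x y ×ˢ Icc c d)) := fun x y =>
    h.isPreconnected_preimage.2 (isPreconnected_Icc.prod isPreconnected_Icc)
  have hmono : ∀ {x y x' y'}, x ≤ x' → y' ≤ y →
      h ⁻¹' (Icc x' y' ×ˢ Icc c d) ⊆ h ⁻¹' (Icc x y ×ˢ Icc c d) := fun hx hy =>
    preimage_mono (prod_mono (Icc_subset_Icc hx hy) subset_rfl)
  obtain ⟨φ, hφ, hφA, hφQ⟩ := hχ.exists_glue hk h hχ' (A := h ⁻¹' (Icc a b ×ˢ Icc c d))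
    (T := h ⁻¹' (Icc b' b ×ˢ Icc c d)) (Q := h ⁻¹' (Icc b e ×ˢ Icc c d))
    (O := {x | b' < (h x).1}) (hcomp _ _) (hconn _ _) hs (hcomp _ _) (hconn _ _) (hcomp _ _)
    (hconn _ _) ((hmono le_rfl hbe).trans hs') ((hmono hb.le le_rfl).trans hs') (hmono hab le_rfl)
    ⟨h.symm (b, c), by simp [hb.le, hcd], by simp [hbe, hcd]⟩
    (isOpen_lt continuous_const (continuous_fst.comp h.continuous))
    (fun x hx => hb.trans_le hx.1.1) (fun x hx => ⟨⟨le_of_lt hx.2, hx.1.1.2⟩, hx.1.2⟩)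
  refine ⟨φ ∘ χ, hφ.comp_isPar hχ, fun x hx => ?_⟩
  rcases le_total (h x).1 b with hxb | hxb
  · have hxA : x ∈ h ⁻¹' (Icc a b ×ˢ Icc c d) := ⟨⟨hx.1.1, hxb⟩, hx.2⟩
    obtain ⟨p, rfl⟩ := hs hxA
    exact ⟨p, hφA _ hxA⟩
  · exact hφQ ⟨⟨hxb, hx.1.2⟩, hx.2⟩

/-- Every rectangle lies in a single chart domain. -/
theorem rectangleInChart [T2Space M] (hk : 1 ≤ k) (h : M ≃ₜ ℝ × ℝ)
    (hloc : ∀ x : M, ∃ c, IsPar I k c ∧ x ∈ range c) {a b c d : ℝ} (hab : a ≤ b) (hcd : c ≤ d) :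
    RectangleInChart I k h a b c d := by
  choose χ hχ hmem using hloc
  obtain ⟨δ, hδ, hball⟩ := lebesgue_number_lemma_of_metric
    (s := Icc a b ×ˢ Icc c d) (c := fun x => h.symm ⁻¹' range (χ x))
    (isCompact_Icc.prod isCompact_Icc) (fun x => (hχ x).isOpen_range.preimage h.symm.continuous)
    (fun p _ => mem_iUnion.2 ⟨h.symm p, hmem _⟩)
  have hsmall : ∀ x ∈ Icc a b, ∀ y ∈ Icc c d,
      RectangleInChart I k h x (x + δ / 2) y (y + δ / 2) := by
    intro x hx y hy
    obtain ⟨i, hi⟩ := hball (x, y) ⟨hx, hy⟩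
    refine ⟨χ i, hχ i, fun z hz => ?_⟩
    have : h z ∈ Metric.ball (x, y) δ := by
      obtain ⟨⟨h1, h2⟩, h3, h4⟩ := hz
      rw [Metric.mem_ball, Prod.dist_eq, max_lt_iff, Real.dist_eq, Real.dist_eq, abs_lt, abs_lt]
      exact ⟨⟨by linarith, by linarith⟩, by linarith, by linarith⟩
    simpa using hi this
  refine interval_gluing (p := fun y y' => RectangleInChart I k h a b y y') hcd (half_pos hδ)
    (fun h1 hx hx' => h1.mono le_rfl le_rfl hx hx')
    (fun hxy hy hyz h1 h2 => rectangleInChart_swap.1 (.glue hk hxy hy hyz hab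
      (rectangleInChart_swap.2 h1) (rectangleInChart_swap.2 h2))) fun y hy => ?_
  exact interval_gluing (p := fun x x' => RectangleInChart I k h x x' y (y + δ / 2)) hab
    (half_pos hδ) (fun h1 hx hx' => h1.mono hx hx' le_rfl le_rfl)
    (fun hxy hy hyz h1 h2 => h1.glue hk hxy hy hyz (by linarith) h2) (fun x hx => hsmall x hx y hy)

end Rectangles

section Exhaustion

variable {E H M : Type*} [NormedAddCommGroup E] [NormedSpace ℝ E] [TopologicalSpace H]
  {I : ModelWithCorners ℝ E H} [TopologicalSpace M] [ChartedSpace H M] {k : ℕ∞}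

/-- The coordinate planes can be enlarged, without changing them on a given ball, so as to engulf
any given compact set. -/
theorem IsPar.exists_enlargement [T2Space M] (hk : 1 ≤ k) (h : M ≃ₜ ℝ × ℝ)
    (hloc : ∀ x : M, ∃ c, IsPar I k c ∧ x ∈ range c) {χ : ℝ × ℝ → M} (hχ : IsPar I k χ)
    {ρ : ℝ} (hρ : 0 ≤ ρ) (N : ℝ) :
    ∃ χ' : ℝ × ℝ → M, IsPar I k χ' ∧ ∃ ρ' : ℝ, ρ + 1 ≤ ρ' ∧
      EqOn χ' χ (Metric.closedBall 0 ρ) ∧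
      h ⁻¹' Metric.closedBall 0 N ⊆ χ' '' Metric.closedBall 0 ρ' := by
  have hKcomp : IsCompact (χ '' Metric.closedBall 0 ρ) :=
    (isCompact_closedBall _ _).image hχ.continuous
  have hKconn : IsPreconnected (χ '' Metric.closedBall 0 ρ) :=
    (convex_closedBall _ _).isPreconnected.image _ hχ.continuous.continuousOn
  obtain ⟨R₀, hR₀⟩ := (hKcomp.image h.continuous).isBounded.subset_closedBall 0
  set R := max N (max R₀ 0) with hR
  have hbox : Metric.closedBall (0 : ℝ × ℝ) R = Icc (-R) R ×ˢ Icc (-R) R := by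
    rw [← Prod.mk_zero_zero, ← closedBall_prod_same, Real.closedBall_eq_Icc, zero_sub, zero_add]
  have hR0 : 0 ≤ R := (le_max_right _ _).trans (le_max_right _ _)
  obtain ⟨c', hc', hs⟩ := rectangleInChart hk h hloc (neg_le_self hR0) (neg_le_self hR0)
  rw [← hbox] at hs
  have hKQ : χ '' Metric.closedBall 0 ρ ⊆ h ⁻¹' Metric.closedBall 0 R := fun x hx =>
    Metric.closedBall_subset_closedBall ((le_max_left _ _).trans (le_max_right _ _))
      (hR₀ (mem_image_of_mem h hx))
  have hQcomp : IsCompact (h ⁻¹' Metric.closedBall 0 R) :=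
    h.isCompact_preimage.2 (isCompact_closedBall _ _)
  obtain ⟨φ, hφ, hφK, hφQ⟩ := hχ.exists_glue hk h hc' hKcomp hKconn (image_subset_range _ _)
    hKcomp hKconn hQcomp (h.isPreconnected_preimage.2 (convex_closedBall _ _).isPreconnected)
    (hKQ.trans hs) hs subset_rfl
    ⟨χ 0, mem_image_of_mem _ (Metric.mem_closedBall_self hρ),
      hKQ (mem_image_of_mem _ (Metric.mem_closedBall_self hρ))⟩
    isOpen_univ (subset_univ _) inter_subset_left
  have hχ' := hφ.comp_isPar hχ
  obtain ⟨ρ₀, hρ₀⟩ :=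
    (hχ'.isOpenEmbedding.isInducing.isCompact_preimage' hQcomp hφQ).isBounded.subset_closedBall 0
  refine ⟨φ ∘ χ, hχ', max (ρ + 1) ρ₀, le_max_left _ _,
    fun p hp => hφK _ (mem_image_of_mem _ hp), fun x hx => ?_⟩
  have hxQ : x ∈ h ⁻¹' Metric.closedBall 0 R :=
    Metric.closedBall_subset_closedBall (le_max_left _ _) hx
  obtain ⟨p, rfl⟩ := hφQ hxQ
  exact ⟨p, Metric.closedBall_subset_closedBall (le_max_right _ _) (hρ₀ hxQ), rfl⟩

/-- Being a local diffeomorphism at a point is a local property. -/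
theorem isLocalDiffeomorphAt_congr {E' H' N : Type*} [NormedAddCommGroup E'] [NormedSpace ℝ E']
    [TopologicalSpace H'] {J : ModelWithCorners ℝ E' H'} [TopologicalSpace N] [ChartedSpace H' N]
    {f g : N → M} {x : N} (hg : IsLocalDiffeomorphAt J I k g x) {O : Set N} (hO : IsOpen O)
    (hx : x ∈ O) (hfg : EqOn f g O) : IsLocalDiffeomorphAt J I k f x := by
  obtain ⟨Φ, hΦ, hΦe⟩ := hg
  let Ψ : PartialDiffeomorph J I N M k :=
    { toPartialEquiv := Φ.toPartialEquiv.restr O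
      open_source := Φ.open_source.inter hO
      open_target := Φ.toOpenPartialHomeomorph.isOpen_inter_preimage_symm hO
      contMDiffOn_toFun := Φ.contMDiffOn_toFun.mono inter_subset_left
      contMDiffOn_invFun := Φ.contMDiffOn_invFun.mono inter_subset_left }
  exact ⟨Ψ, ⟨hΦ, hx⟩, fun y hy => (hfg hy.2).trans (hΦe hy.1)⟩

/-- A manifold homeomorphic to the plane, and covered by coordinate planes, is diffeomorphic to
the plane. -/
theorem exists_isPar_surjective [T2Space M] (hk : 1 ≤ k) (h : M ≃ₜ ℝ × ℝ)
    (hloc : ∀ x : M, ∃ c, IsPar I k c ∧ x ∈ range c) :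
    ∃ F : ℝ × ℝ → M, IsPar I k F ∧ Function.Surjective F := by
  let S := {s : (ℝ × ℝ → M) × ℝ // IsPar I k s.1 ∧ 0 ≤ s.2}
  have hstep : ∀ (s : S) (N : ℕ), ∃ s' : S, s.1.2 + 1 ≤ s'.1.2 ∧
      EqOn s'.1.1 s.1.1 (Metric.closedBall 0 s.1.2) ∧
      h ⁻¹' Metric.closedBall 0 N ⊆ s'.1.1 '' Metric.closedBall 0 s'.1.2 := by
    rintro ⟨⟨χ, ρ⟩, hχ, hρ⟩ N
    obtain ⟨χ', hχ', ρ', h1, h2, h3⟩ := hχ.exists_enlargement hk h hloc hρ N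
    exact ⟨⟨(χ', ρ'), hχ', by simp only at hρ ⊢; linarith⟩, h1, h2, h3⟩
  choose next hnext1 hnext2 hnext3 using hstep
  obtain ⟨c₀, hc₀, -⟩ := hloc (h.symm 0)
  let s : ℕ → S := fun n => Nat.rec ⟨(c₀, 0), hc₀, le_rfl⟩ (fun n t => next t n) n
  let χ : ℕ → ℝ × ℝ → M := fun n => (s n).1.1
  let ρ : ℕ → ℝ := fun n => (s n).1.2
  have hχ : ∀ n, IsPar I k (χ n) := fun n => (s n).2.1
  have hρs : ∀ n, ρ n + 1 ≤ ρ (n + 1) := fun n => hnext1 (s n) n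
  have hρ : ∀ n : ℕ, (n : ℝ) ≤ ρ n := by
    intro n
    induction n with
    | zero => simpa using (s 0).2.2
    | succ n ih => push_cast; linarith [hρs n]
  have hρm : Monotone ρ := monotone_nat_of_le_succ fun n => by linarith [hρs n]
  have heq : ∀ {n m}, n ≤ m → EqOn (χ m) (χ n) (Metric.closedBall 0 (ρ n)) := by
    intro n m hnm
    induction m, hnm using Nat.le_induction with
    | base => exact fun _ _ => rfl
    | succ m hnm ih =>
      exact fun p hp => (hnext2 (s m) m
        (Metric.closedBall_subset_closedBall (hρm hnm) hp)).trans (ih hp)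
  let F : ℝ × ℝ → M := fun p => χ ⌈‖p‖⌉₊ p
  have hF : ∀ n, EqOn F (χ n) (Metric.closedBall 0 (ρ n)) := by
    intro n p hp
    have hp' : p ∈ Metric.closedBall 0 (ρ ⌈‖p‖⌉₊) :=
      mem_closedBall_zero_iff.2 ((Nat.le_ceil _).trans (hρ _))
    rcases le_total n ⌈‖p‖⌉₊ with hle | hle
    · exact heq hle hp
    · exact (heq hle hp').symm
  have hmem : ∀ {p : ℝ × ℝ} {n : ℕ}, ‖p‖ ≤ n → p ∈ Metric.closedBall 0 (ρ n) := fun hp =>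
    mem_closedBall_zero_iff.2 (hp.trans (hρ _))
  refine ⟨F, ⟨fun p => ?_, fun p q hpq => ?_⟩, fun x => ?_⟩
  · obtain ⟨n, hn⟩ := exists_nat_gt ‖p‖
    exact isLocalDiffeomorphAt_congr ((hχ n).1 p) Metric.isOpen_ball
      (mem_ball_zero_iff.2 (hn.trans_le (hρ n))) ((hF n).mono Metric.ball_subset_closedBall)
  · obtain ⟨n, hn⟩ := exists_nat_gt (max ‖p‖ ‖q‖)
    rw [max_lt_iff] at hn
    rw [hF n (hmem hn.1.le), hF n (hmem hn.2.le)] at hpq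
    exact (hχ n).2 hpq
  · obtain ⟨n, hn⟩ := exists_nat_gt ‖h x‖
    obtain ⟨p, hp, rfl⟩ := hnext3 (s n) n (mem_closedBall_zero_iff.2 hn.le)
    exact ⟨p, hF (n + 1) hp⟩

end Exhaustion

/-- A continuous linear equivalence as a `C^k` diffeomorphism. -/
def linearDiffeomorph {E F : Type*} [NormedAddCommGroup E] [NormedSpace ℝ E]
    [NormedAddCommGroup F] [NormedSpace ℝ F] (k : ℕ∞) (L : E ≃L[ℝ] F) :
    E ≃ₘ^k⟮𝓘(ℝ, E), 𝓘(ℝ, F)⟯ F where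
  toEquiv := L.toEquiv
  contMDiff_toFun := L.contDiff.contMDiff
  contMDiff_invFun := L.symm.contDiff.contMDiff

/-- Around every point of a `C^k` surface there is a coordinate plane. -/
theorem exists_isPar_mem_range {E M : Type*} [NormedAddCommGroup E] [InnerProductSpace ℝ E]
    [TopologicalSpace M] [ChartedSpace E M] {k : ℕ∞} [IsManifold 𝓘(ℝ, E) k M]
    (L : (ℝ × ℝ) ≃L[ℝ] E) (x : M) : ∃ c, IsPar 𝓘(ℝ, E) k c ∧ x ∈ range c := by
  set e := chartAt E x with he
  obtain ⟨r, hr, hball⟩ := Metric.isOpen_iff.1 e.open_target (e x) (mem_chart_target E x)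
  let Φ : PartialDiffeomorph 𝓘(ℝ, E) 𝓘(ℝ, E) E M k :=
    { toPartialEquiv := e.symm.toPartialEquiv
      open_source := e.open_target
      open_target := e.open_source
      contMDiffOn_toFun := contMDiffOn_chart_symm
      contMDiffOn_invFun := contMDiffOn_chart }
  let U := OpenPartialHomeomorph.univBall (e x) r
  have hUt : U.target = Metric.ball (e x) r := OpenPartialHomeomorph.univBall_target _ hr
  have hUs : U.source = univ := OpenPartialHomeomorph.univBall_source _ _
  let Υ : PartialDiffeomorph 𝓘(ℝ, E) 𝓘(ℝ, E) E E k :=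
    { toPartialEquiv := U.toPartialEquiv
      open_source := U.open_source
      open_target := U.open_target
      contMDiffOn_toFun := OpenPartialHomeomorph.contDiff_univBall.contMDiff.contMDiffOn
      contMDiffOn_invFun := by
        rw [hUt]; exact OpenPartialHomeomorph.contDiffOn_univBall_symm.contMDiffOn }
  have hU : ∀ y, U y ∈ e.target := fun y =>
    hball (hUt ▸ U.map_source (hUs ▸ mem_univ y))
  have hL : IsLocalDiffeomorph 𝓘(ℝ, ℝ × ℝ) 𝓘(ℝ, E) k L :=
    (linearDiffeomorph k L).isLocalDiffeomorph
  refine ⟨e.symm ∘ U ∘ L, ⟨fun p => ?_, fun p q hpq => ?_⟩, L.symm 0, ?_⟩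
  · have h1 : IsLocalDiffeomorphAt 𝓘(ℝ, E) 𝓘(ℝ, E) k U (L p) :=
      ⟨Υ, hUs ▸ mem_univ _, fun _ _ => rfl⟩
    have h2 : IsLocalDiffeomorphAt 𝓘(ℝ, E) 𝓘(ℝ, E) k e.symm (U (L p)) :=
      ⟨Φ, hU _, fun _ _ => rfl⟩
    exact ((hL p).comp 𝓘(ℝ, E) E h1).comp 𝓘(ℝ, E) M h2
  · have h1 := e.symm.injOn (hU _) (hU _) hpq
    exact L.injective (U.injOn (hUs ▸ mem_univ _) (hUs ▸ mem_univ _) h1)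
  · simp only [Function.comp_apply, ContinuousLinearEquiv.apply_symm_apply]
    rw [show U 0 = e x from OpenPartialHomeomorph.univBall_apply_zero _ _]
    exact e.left_inv (mem_chart_source E x)

end PlaneStructure

/-- No exotic C^k structures on ℝ²: any C^k manifold structure (`k ≥ 1`, possibly `∞`)
on a topological space homeomorphic to ℝ² is C^k-diffeomorphic to ℝ² with its standard
C^k structure. -/
theorem stmt_15 (k : ℕ∞) (hk : 1 ≤ k)
    (M : Type) [TopologicalSpace M]
    [ChartedSpace (EuclideanSpace ℝ (Fin 2)) M]
    [HasGroupoid M (contDiffGroupoid k (modelWithCornersSelf ℝ (EuclideanSpace ℝ (Fin 2))))]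
    (htop : Nonempty (M ≃ₜ EuclideanSpace ℝ (Fin 2))) :
    ∃ h : M → EuclideanSpace ℝ (Fin 2), Function.Bijective h ∧
      ContMDiff (modelWithCornersSelf ℝ (EuclideanSpace ℝ (Fin 2)))
        (modelWithCornersSelf ℝ (EuclideanSpace ℝ (Fin 2))) k h ∧
      ∃ hinv : EuclideanSpace ℝ (Fin 2) → M,
        (∀ x, hinv (h x) = x) ∧ (∀ y, h (hinv y) = y) ∧
        ContMDiff (modelWithCornersSelf ℝ (EuclideanSpace ℝ (Fin 2)))
          (modelWithCornersSelf ℝ (EuclideanSpace ℝ (Fin 2))) k hinv := by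
  obtain ⟨h₀⟩ := htop
  have : T2Space M := h₀.isEmbedding.t2Space
  have : IsManifold 𝓘(ℝ, EuclideanSpace ℝ (Fin 2)) k M := { }
  let L : (ℝ × ℝ) ≃L[ℝ] EuclideanSpace ℝ (Fin 2) := .ofFinrankEq (by simp)
  obtain ⟨F, hF, hFs⟩ := PlaneStructure.exists_isPar_surjective hk
    (h₀.trans L.symm.toHomeomorph)
    (PlaneStructure.exists_isPar_mem_range (k := k) (M := M) L)
  let Φ := (hF.1.diffeomorphOfBijective ⟨hF.2, hFs⟩).symm.trans
    (PlaneStructure.linearDiffeomorph k L)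
  exact ⟨Φ, Φ.bijective, Φ.contMDiff, Φ.symm, Φ.left_inv, Φ.right_inv, Φ.symm.contMDiff⟩

end
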